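/- arXiv:2101.02473 — 4 statements merged into one kernel-verified Lean document; each statement's English description precedes it below -/
import Mathlib

section
/- For every x ∈ ℝ, the principal value PV∫_ℝ e^{−y²}/(x−y) dy exists and equals 2√π·D(x), where D(x) = e^{−x²}·∫_0^x e^{t²} dt is Dawson's integral. -/
open MeasureTheory Filter Set Topology

/-- The kernel `2 exp (2tu - u²)` is integrable for `t` in a bounded interval and `u ∈ ℝ`. -/
lemma integrable_uIoc_prod_exp_two_mul_sub_sq (x : ℝ) :
    Integrable (fun p : ℝ × ℝ => 2 * Real.exp (2 * p.1 * p.2 - p.2 ^ 2))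
      ((volume.restrict (uIoc 0 x)).prod volume) := by
  have h1 : Integrable (fun t : ℝ => 2 * Real.exp (2 * t ^ 2)) (volume.restrict (uIoc 0 x)) :=
    intervalIntegrable_iff.mp (Continuous.intervalIntegrable (by fun_prop) 0 x)
  have h2 : Integrable (fun u : ℝ => Real.exp (-(1 / 2) * u ^ 2)) :=
    integrable_exp_neg_mul_sq (by norm_num)
  refine (h1.mul_prod h2).mono' (by fun_prop) (.of_forall fun p => ?_)
  rw [Real.norm_of_nonneg (by positivity), mul_assoc 2 (Real.exp _), ← Real.exp_add]
  gcongr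
  nlinarith [sq_nonneg (2 * p.1 - p.2)]

lemma intervalIntegral_two_mul_exp (x : ℝ) {u : ℝ} (hu : u ≠ 0) :
    ∫ t in (0 : ℝ)..x, 2 * Real.exp (2 * t * u - u ^ 2) =
      Real.exp (-u ^ 2) * ((Real.exp (2 * x * u) - 1) / u) := by
  have h (t : ℝ) : HasDerivAt (fun t => Real.exp (2 * t * u - u ^ 2) / u)
      (2 * Real.exp (2 * t * u - u ^ 2)) t := by
    have := ((((hasDerivAt_id t).const_mul 2).mul_const u).sub_const (u ^ 2)).exp.div_const u
    refine this.congr_deriv ?_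
    simp only [id]
    field_simp
  rw [intervalIntegral.integral_eq_sub_of_hasDerivAt (fun t _ => h t)
    (Continuous.intervalIntegrable (by fun_prop) _ _)]
  rw [sub_eq_add_neg (2 * x * u), sub_eq_add_neg (2 * 0 * u), Real.exp_add, Real.exp_add]
  simp
  ring

lemma integral_exp_two_mul_sub_sq (t : ℝ) :
    ∫ u : ℝ, 2 * Real.exp (2 * t * u - u ^ 2) =
      2 * Real.sqrt Real.pi * Real.exp (t ^ 2) := by
  have h (u : ℝ) : 2 * Real.exp (2 * t * u - u ^ 2) =
      2 * Real.exp (t ^ 2) * Real.exp (-1 * (u - t) ^ 2) := by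
    rw [mul_assoc 2 (Real.exp _), ← Real.exp_add]
    ring_nf
  simp_rw [h]
  rw [integral_const_mul, integral_sub_right_eq_self (fun u : ℝ => Real.exp (-1 * u ^ 2)) t,
    integral_gaussian, div_one]
  ring

lemma integrable_exp_mul_exp_sub_one_div (x : ℝ) :
    Integrable (fun u : ℝ => Real.exp (-u ^ 2) * ((Real.exp (2 * x * u) - 1) / u)) := by
  have h := (integrable_uIoc_prod_exp_two_mul_sub_sq x).integral_prod_right
  have h' : Integrable (fun u : ℝ => ∫ t in (0 : ℝ)..x, 2 * Real.exp (2 * t * u - u ^ 2)) := by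
    simp_rw [intervalIntegral.intervalIntegral_eq_integral_uIoc]
    exact h.smul (_ : ℝ)
  refine h'.congr ?_
  filter_upwards [volume.ae_ne 0] with u hu using intervalIntegral_two_mul_exp x hu

lemma integral_exp_mul_exp_sub_one_div (x : ℝ) :
    ∫ u : ℝ, Real.exp (-u ^ 2) * ((Real.exp (2 * x * u) - 1) / u) =
      2 * Real.sqrt Real.pi * ∫ t in (0 : ℝ)..x, Real.exp (t ^ 2) := by
  calc _ = ∫ u : ℝ, ∫ t in (0 : ℝ)..x, 2 * Real.exp (2 * t * u - u ^ 2) := by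
        refine integral_congr_ae ?_
        filter_upwards [volume.ae_ne 0] with u hu using (intervalIntegral_two_mul_exp x hu).symm
    _ = ∫ t in (0 : ℝ)..x, ∫ u : ℝ, 2 * Real.exp (2 * t * u - u ^ 2) :=
        (intervalIntegral_integral_swap (integrable_uIoc_prod_exp_two_mul_sub_sq x)).symm
    _ = _ := by
        simp_rw [integral_exp_two_mul_sub_sq]
        rw [intervalIntegral.integral_const_mul]

lemma measurableSet_lt_abs (ε : ℝ) : MeasurableSet {u : ℝ | ε < |u|} :=
  measurableSet_lt measurable_const measurable_id.abs

lemma integrableOn_exp_neg_sq_div {ε : ℝ} (hε : 0 < ε) :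
    IntegrableOn (fun u : ℝ => Real.exp (-u ^ 2) / u) {u | ε < |u|} := by
  have h : Integrable (fun u : ℝ => ε⁻¹ * Real.exp (-1 * u ^ 2)) :=
    (integrable_exp_neg_mul_sq one_pos).const_mul _
  refine h.integrableOn.mono' (by fun_prop : Measurable _).aestronglyMeasurable ?_
  filter_upwards [ae_restrict_mem (measurableSet_lt_abs ε)] with u hu
  have hu : ε < |u| := hu
  rw [norm_div, Real.norm_of_nonneg (Real.exp_pos _).le, Real.norm_eq_abs, neg_one_mul,
    div_eq_inv_mul]
  gcongr

lemma setIntegral_exp_neg_sq_div (ε : ℝ) :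
    ∫ u in {u : ℝ | ε < |u|}, Real.exp (-u ^ 2) / u = 0 := by
  rw [← integral_indicator (measurableSet_lt_abs ε)]
  set f := indicator {u : ℝ | ε < |u|} fun u => Real.exp (-u ^ 2) / u
  have hf (u : ℝ) : f (-u) = -f u := by
    by_cases h : ε < |u| <;> simp [f, h, div_neg]
  have := integral_neg_eq_self f volume
  simp_rw [hf, integral_neg] at this
  linarith

lemma setIntegral_exp_neg_sq_div_sub (x : ℝ) {ε : ℝ} (hε : 0 < ε) :
    ∫ y in {y : ℝ | ε < |y - x|}, Real.exp (-y ^ 2) / (x - y) =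
      Real.exp (-x ^ 2) * ∫ u in {u : ℝ | ε < |u|},
        Real.exp (-u ^ 2) * ((Real.exp (2 * x * u) - 1) / u) := by
  have hS : MeasurableSet {y : ℝ | ε < |y - x|} :=
    measurableSet_lt measurable_const (measurable_id.sub_const x).abs
  have hsplit (u : ℝ) : Real.exp (-(x - u) ^ 2) / u = Real.exp (-x ^ 2) *
      (Real.exp (-u ^ 2) * ((Real.exp (2 * x * u) - 1) / u) + Real.exp (-u ^ 2) / u) := by
    rw [show -(x - u) ^ 2 = -x ^ 2 + -u ^ 2 + 2 * x * u by ring, Real.exp_add, Real.exp_add]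
    ring
  calc _ = ∫ u in {u : ℝ | ε < |u|}, Real.exp (-(x - u) ^ 2) / u := by
        rw [← integral_indicator hS, ← integral_indicator (measurableSet_lt_abs ε),
          ← integral_sub_left_eq_self _ volume x]
        simp [indicator]
    _ = _ := by
        simp_rw [hsplit]
        rw [integral_const_mul, integral_add (integrable_exp_mul_exp_sub_one_div x).integrableOn
          (integrableOn_exp_neg_sq_div hε), setIntegral_exp_neg_sq_div, add_zero]

lemma aecover_lt_abs : AECover (volume : Measure ℝ) (𝓝[>] 0) fun ε : ℝ => {u : ℝ | ε < |u|} where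
  ae_eventually_mem := by
    filter_upwards [volume.ae_ne 0] with u hu
    exact mem_nhdsWithin_of_mem_nhds (Iio_mem_nhds (abs_pos.mpr hu))
  measurableSet := measurableSet_lt_abs

/-- For every `x ∈ ℝ`, the principal value `PV∫_ℝ e^{−y²}/(x−y) dy`
exists and equals `2√π·D(x)`, where `D(x) = e^{−x²}·∫_0^x e^{t²} dt` is Dawson's
integral. -/
theorem pv_gaussian_dawson (x : ℝ) :
    Tendsto
      (fun ε : ℝ => ∫ y in {y : ℝ | ε < |y - x|}, Real.exp (-y ^ 2) / (x - y))
      (𝓝[>] 0)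
      (𝓝 (2 * Real.sqrt Real.pi * (Real.exp (-x ^ 2) * ∫ t in (0 : ℝ)..x, Real.exp (t ^ 2)))) := by
  have h := (aecover_lt_abs.integral_tendsto_of_countably_generated
    (integrable_exp_mul_exp_sub_one_div x)).const_mul (Real.exp (-x ^ 2))
  rw [integral_exp_mul_exp_sub_one_div, mul_left_comm] at h
  refine h.congr' ?_
  filter_upwards [self_mem_nhdsWithin] with ε hε using (setIntegral_exp_neg_sq_div_sub x hε).symm
end

section
/- For every x ∈ ℝ, the principal value PV∫_ℝ sech(y)/(x−y) dy exists and equals −π·tanh(x) − i·(ψ(1/4 + ix/(2π)) − ψ(1/4 − ix/(2π))), where ψ is the digamma function; in particular the right-hand side is real, since ψ(1/4 − ix/(2π)) is the complex conjugate of ψ(1/4 + ix/(2π)). -/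
open MeasureTheory Filter Set Topology

/-- The digamma function `ψ = Γ'/Γ`, the logarithmic derivative of the complex
Gamma function. -/
noncomputable def digamma (z : ℂ) : ℂ := deriv Complex.Gamma z / Complex.Gamma z

theorem norm_GammaSeq_le {z : ℂ} (hz : 0 < z.re) {n : ℕ} (hn : n ≠ 0) :
    ‖Complex.GammaSeq z n‖ ≤ Real.Gamma z.re := by
  have hpos : ∀ m ∈ Finset.range (n + 1), 0 < z.re + (m : ℝ) := fun m _ => by positivity
  have hn' : (0 : ℝ) < n := by positivity
  have h1 : ‖Complex.GammaSeq z n‖ ≤ Real.GammaSeq z.re n := by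
    rw [Complex.GammaSeq, Real.GammaSeq, norm_div, norm_mul, norm_prod,
      Complex.norm_natCast_cpow_of_pos (by omega), Complex.norm_natCast]
    refine div_le_div_of_nonneg_left (by positivity) (Finset.prod_pos hpos)
      (Finset.prod_le_prod (fun m hm => (hpos m hm).le) fun m _ => ?_)
    simpa using Complex.re_le_norm (z + m)
  have h2 : Real.BohrMollerup.logGammaSeq z.re n = Real.log (Real.GammaSeq z.re n) := by
    rw [Real.GammaSeq, Real.log_div (by positivity) (Finset.prod_pos hpos).ne',
      Real.log_mul (by positivity) (by positivity), Real.log_rpow hn',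
      Real.log_prod (fun m hm => (hpos m hm).ne'), Real.BohrMollerup.logGammaSeq]
  have h3 := Real.BohrMollerup.ge_logGammaSeq (f := Real.log ∘ Real.Gamma)
    Real.convexOn_log_Gamma (fun {y} hy => by
      rw [Function.comp_apply, Real.Gamma_add_one hy.ne',
        Real.log_mul hy.ne' (Real.Gamma_pos_of_pos hy).ne', add_comm, Function.comp_apply])
    hz hn
  simp only [Function.comp_apply, Real.Gamma_one, Real.log_one, zero_add] at h3
  rw [h2] at h3
  have h4 : 0 < Real.GammaSeq z.re n := div_pos (by positivity) (Finset.prod_pos hpos)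
  exact h1.trans ((Real.log_le_log_iff h4 (Real.Gamma_pos_of_pos hz)).1 h3)

theorem ne_neg_natCast_of_re_pos {z : ℂ} (hz : 0 < z.re) (m : ℕ) : z ≠ -m := by
  rintro rfl
  simp only [Complex.neg_re, Complex.natCast_re, Left.neg_pos_iff] at hz
  exact absurd hz (not_lt.2 m.cast_nonneg)

theorem add_natCast_ne_zero_of_re_pos {z : ℂ} (hz : 0 < z.re) (m : ℕ) : z + m ≠ 0 := fun h =>
  ne_neg_natCast_of_re_pos hz m (eq_neg_of_add_eq_zero_left h)

theorem differentiableAt_GammaSeq {z : ℂ} (hz : 0 < z.re) {n : ℕ} (hn : n ≠ 0) :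
    DifferentiableAt ℂ (fun w => Complex.GammaSeq w n) z := by
  unfold Complex.GammaSeq
  have hn' : (n : ℂ) ≠ 0 := by exact_mod_cast hn
  refine DifferentiableAt.fun_div ?_ (by fun_prop)
    (Finset.prod_ne_zero_iff.2 fun m _ => add_natCast_ne_zero_of_re_pos hz m)
  exact (DifferentiableAt.const_cpow differentiableAt_id (Or.inl hn')).mul_const _

theorem tendsto_deriv_GammaSeq {z : ℂ} (hz : 0 < z.re) :
    Tendsto (fun n => deriv (fun w => Complex.GammaSeq w n) z) atTop
      (𝓝 (deriv Complex.Gamma z)) := by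
  set r := z.re / 2 with hr
  have hr0 : 0 < r := by positivity
  have hU : IsOpen {w : ℂ | 0 < w.re} := isOpen_lt continuous_const Complex.continuous_re
  have hball : Metric.closedBall z r ⊆ {w : ℂ | 0 < w.re} := by
    intro w hw
    have h1 := (Complex.abs_re_le_norm (w - z)).trans (mem_closedBall_iff_norm.1 hw)
    rw [Complex.sub_re, abs_le] at h1
    simp only [mem_ofPred_eq]
    linarith
  have hmem : ∀ θ, 0 < (circleMap z r θ).re := fun θ =>
    hball (circleMap_mem_closedBall z hr0.le θ)
  have hd : DifferentiableOn ℂ Complex.Gamma {w : ℂ | 0 < w.re} := fun w hw =>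
    (Complex.differentiableAt_Gamma w (ne_neg_natCast_of_re_pos hw)).differentiableWithinAt
  have hdn : ∀ n : ℕ, n ≠ 0 →
      DifferentiableOn ℂ (fun w => Complex.GammaSeq w n) {w : ℂ | 0 < w.re} := fun n hn w hw =>
    (differentiableAt_GammaSeq hw hn).differentiableWithinAt
  rw [← Complex.cderiv_eq_deriv hU hd hr0 hball]
  refine Tendsto.congr' (f₁ := fun n => Complex.cderiv r (fun w => Complex.GammaSeq w n) z) ?_ ?_
  · filter_upwards [eventually_ne_atTop 0] with n hn
    exact Complex.cderiv_eq_deriv hU (hdn n hn) hr0 hball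
  have hne : ∀ θ, (circleMap z r θ - z) ^ 2 ≠ 0 := fun θ => by
    simp [circleMap_sub_center, hr0.ne']
  have hcont : Continuous fun θ : ℝ => deriv (circleMap z r) θ := by
    simp only [deriv_circleMap]
    fun_prop
  have hcont2 : Continuous fun θ : ℝ => ((circleMap z r θ - z) ^ 2)⁻¹ :=
    Continuous.inv₀ (by fun_prop) hne
  refine Tendsto.const_smul ?_ _
  unfold circleIntegral
  refine intervalIntegral.tendsto_integral_filter_of_dominated_convergence
    (fun θ => ‖deriv (circleMap z r) θ‖ * (‖((circleMap z r θ - z) ^ 2)⁻¹‖ *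
      Real.Gamma (circleMap z r θ).re)) ?_ ?_ ?_ ?_
  · filter_upwards [eventually_ne_atTop 0] with n hn
    refine Continuous.aestronglyMeasurable (hcont.smul (hcont2.smul ?_))
    exact continuous_iff_continuousAt.2 fun θ =>
      ContinuousAt.comp (f := circleMap z r) (g := fun w => Complex.GammaSeq w n)
        (differentiableAt_GammaSeq (hmem θ) hn).continuousAt (by fun_prop)
  · filter_upwards [eventually_ne_atTop 0] with n hn
    refine Eventually.of_forall fun θ _ => ?_
    rw [norm_smul, norm_smul]
    gcongr
    exact norm_GammaSeq_le (hmem θ) hn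
  · refine Continuous.intervalIntegrable (hcont.norm.mul (hcont2.norm.mul ?_)) _ _
    exact continuous_iff_continuousAt.2 fun θ =>
      ContinuousAt.comp (f := fun θ => (circleMap z r θ).re) (g := Real.Gamma)
        ((Real.differentiableOn_Gamma_Ioi.differentiableAt
          (Ioi_mem_nhds (hmem θ))).continuousAt) (by fun_prop)
  · exact Eventually.of_forall fun θ _ =>
      ((Complex.GammaSeq_tendsto_Gamma _).const_smul _).const_smul _

theorem logDeriv_GammaSeq {z : ℂ} (hz : 0 < z.re) {n : ℕ} (hn : n ≠ 0) :
    logDeriv (fun w => Complex.GammaSeq w n) z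
      = Complex.log n - ∑ j ∈ Finset.range (n + 1), 1 / (z + j) := by
  have hn' : (n : ℂ) ≠ 0 := by exact_mod_cast hn
  have hd : HasDerivAt (fun w : ℂ => (n : ℂ) ^ w) ((n : ℂ) ^ z * Complex.log n) z := by
    simpa using (hasDerivAt_id z).const_cpow (Or.inl hn')
  have hne : (n : ℂ) ^ z ≠ 0 := by simp [Complex.cpow_eq_zero_iff, hn']
  have hfac : (n.factorial : ℂ) ≠ 0 := by exact_mod_cast n.factorial_ne_zero
  unfold Complex.GammaSeq
  rw [logDeriv_div (f := fun w => (n : ℂ) ^ w * n.factorial)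
    (g := fun w => ∏ j ∈ Finset.range (n + 1), (w + (j : ℂ))) z (mul_ne_zero hne hfac)
    (Finset.prod_ne_zero_iff.2 fun m _ => add_natCast_ne_zero_of_re_pos hz m)
    (hd.differentiableAt.mul_const _) (by fun_prop), logDeriv_mul_const _ _ hfac,
    logDeriv_prod (fun m _ => add_natCast_ne_zero_of_re_pos hz m) (fun m _ => by fun_prop)]
  congr 1
  · rw [logDeriv_apply, hd.deriv, mul_div_cancel_left₀ _ hne]
  · simp [logDeriv_apply]

theorem tendsto_log_sub_sum_digamma {z : ℂ} (hz : 0 < z.re) :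
    Tendsto (fun n : ℕ => Complex.log n - ∑ j ∈ Finset.range (n + 1), 1 / (z + j)) atTop
      (𝓝 (digamma z)) := by
  refine Tendsto.congr' ?_ ((tendsto_deriv_GammaSeq hz).div (Complex.GammaSeq_tendsto_Gamma z)
    (Complex.Gamma_ne_zero_of_re_pos hz))
  filter_upwards [eventually_ne_atTop 0] with n hn
  rw [← logDeriv_GammaSeq hz hn, logDeriv_apply, Pi.div_apply]

theorem digamma_conj (z : ℂ) (hz : 0 < z.re) :
    digamma (starRingEnd ℂ z) = starRingEnd ℂ (digamma z) := by
  have h := (Complex.differentiableAt_Gamma z (ne_neg_natCast_of_re_pos hz)).hasDerivAt.conj_conj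
  have hG : (starRingEnd ℂ ∘ Complex.Gamma ∘ starRingEnd ℂ) = Complex.Gamma := by
    ext w
    simp [Complex.Gamma_conj]
  rw [hG] at h
  rw [digamma, digamma, h.deriv, Complex.Gamma_conj, map_div₀]

theorem tendsto_sum_cot {z : ℂ} (hz : z ∈ Complex.integerComplement) :
    Tendsto (fun N : ℕ => ∑ k ∈ Finset.range (N + 1), 1 / (z + k)
      + ∑ k ∈ Finset.range N, 1 / (z - (k + 1))) atTop
      (𝓝 (Real.pi * Complex.cot (Real.pi * z))) := by
  have h := (tendsto_logDeriv_euler_cot_sub hz).add_const (1 / z)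
  rw [sub_add_cancel] at h
  refine h.congr fun N => ?_
  simp only [cotTerm, Finset.sum_add_distrib]
  rw [Finset.sum_range_succ' (fun k : ℕ => 1 / (z + (k : ℂ)))]
  push_cast
  ring

theorem cot_pi_div_four_add_mul_I (y : ℝ) :
    Complex.cot (Real.pi / 4 + y / 2 * Complex.I)
      = ((1 / Real.cosh y : ℝ) : ℂ) - (Real.tanh y : ℝ) * Complex.I := by
  have h1 : (Real.cosh y : ℂ) ≠ 0 := by exact_mod_cast (Real.cosh_pos y).ne'
  set w : ℂ := Real.pi / 4 + y / 2 * Complex.I with hw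
  have h2 : Complex.cos (2 * w) = - (Complex.I * Real.sinh y) := by
    have : 2 * w = y * Complex.I + Real.pi / 2 := by rw [hw]; ring
    rw [this, Complex.cos_add_pi_div_two, Complex.sin_mul_I, ← Complex.ofReal_sinh]; ring
  have h3 : Complex.sin (2 * w) = Real.cosh y := by
    have : 2 * w = y * Complex.I + Real.pi / 2 := by rw [hw]; ring
    rw [this, Complex.sin_add_pi_div_two, Complex.cos_mul_I, ← Complex.ofReal_cosh]
  have h4 : Complex.sin w ≠ 0 := by
    intro h
    rw [Complex.sin_two_mul, h] at h3
    exact h1 (by rw [← h3]; ring)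
  have h5 : Complex.cos w ≠ 0 := by
    intro h
    rw [Complex.sin_two_mul, h] at h3
    exact h1 (by rw [← h3]; ring)
  have h6 : Complex.cot w = (1 + Complex.cos (2 * w)) / Complex.sin (2 * w) := by
    rw [Complex.cot, Complex.sin_two_mul, Complex.cos_two_mul]
    field_simp
    ring
  rw [h6, h2, h3, Real.tanh_eq_sinh_div_cosh]
  push_cast
  field_simp
  ring

/-- The real part of `2 / (a + i y)`. -/
noncomputable def polePairRe (a y : ℝ) : ℝ := 2 * a / (a ^ 2 + y ^ 2)

/-- The negative imaginary part of `2 / (a + i y)`. -/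
noncomputable def polePairIm (a y : ℝ) : ℝ := 2 * y / (a ^ 2 + y ^ 2)

theorem im_ofReal_div_two_pi (y : ℝ) : ((y : ℂ) / (2 * Real.pi)).im = 0 := by
  rw [show (y : ℂ) / (2 * Real.pi) = ((y / (2 * Real.pi) : ℝ) : ℂ) by push_cast; rfl,
    Complex.ofReal_im]

theorem one_div_add_mul_I (c y : ℝ) (hc : 0 < c) :
    1 / ((c : ℂ) + y / (2 * Real.pi) * Complex.I)
      = Real.pi * ((polePairRe (2 * Real.pi * c) y : ℝ)
        - (polePairIm (2 * Real.pi * c) y : ℝ) * Complex.I) := by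
  have hpi := Real.pi_pos
  have hD : ((2 * Real.pi * c) ^ 2 + y ^ 2) ≠ 0 := by positivity
  have hD' : ((2 * Real.pi * c) ^ 2 + y ^ 2 : ℂ) ≠ 0 := by exact_mod_cast hD
  have hpi' : (Real.pi : ℂ) ≠ 0 := by exact_mod_cast hpi.ne'
  have hz : (c : ℂ) + y / (2 * Real.pi) * Complex.I ≠ 0 := by
    intro h
    have := congrArg Complex.re h
    rw [Complex.add_re, Complex.mul_I_re, im_ofReal_div_two_pi] at this
    simp only [Complex.ofReal_re, neg_zero, add_zero, Complex.zero_re] at this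
    exact hc.ne' this
  rw [polePairRe, polePairIm, div_eq_iff hz]
  push_cast
  rw [div_mul_eq_mul_div, div_sub_div_same, mul_div_assoc', div_mul_eq_mul_div,
    eq_div_iff hD', one_mul]
  field_simp
  linear_combination ((y : ℂ) ^ 2) * Complex.I_sq

theorem tendsto_sum_polePair (y : ℝ) :
    Tendsto (fun N : ℕ =>
      ∑ k ∈ Finset.range (N + 1), polePairRe (2 * Real.pi * (k + 1 / 4)) y
        - ∑ k ∈ Finset.range N, polePairRe (2 * Real.pi * (k + 3 / 4)) y)
      atTop (𝓝 (1 / Real.cosh y)) ∧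
    Tendsto (fun N : ℕ =>
      ∑ k ∈ Finset.range (N + 1), polePairIm (2 * Real.pi * (k + 1 / 4)) y
        + ∑ k ∈ Finset.range N, polePairIm (2 * Real.pi * (k + 3 / 4)) y)
      atTop (𝓝 (Real.tanh y)) := by
  have hpi' : (Real.pi : ℂ) ≠ 0 := by exact_mod_cast Real.pi_pos.ne'
  set z : ℂ := 1 / 4 + y / (2 * Real.pi) * Complex.I with hz
  have hzre : z.re = 1 / 4 := by
    rw [hz, Complex.add_re, Complex.mul_I_re, im_ofReal_div_two_pi]
    norm_num
  have hzc : z ∈ Complex.integerComplement := by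
    rintro ⟨m, hm⟩
    have h := congrArg Complex.re hm
    rw [hzre, Complex.intCast_re] at h
    have h4 : (4 * m : ℝ) = 1 := by rw [h]; norm_num
    have h4' : 4 * m = 1 := by exact_mod_cast h4
    omega
  have h := (tendsto_sum_cot hzc).const_mul ((Real.pi : ℂ)⁻¹)
  rw [inv_mul_cancel_left₀ hpi', show (Real.pi : ℂ) * z = Real.pi / 4 + y / 2 * Complex.I by
    rw [hz]; field_simp, cot_pi_div_four_add_mul_I] at h
  have key : ∀ N : ℕ, (Real.pi : ℂ)⁻¹ * (∑ k ∈ Finset.range (N + 1), 1 / (z + k)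
      + ∑ k ∈ Finset.range N, 1 / (z - (k + 1))) =
      ((∑ k ∈ Finset.range (N + 1), polePairRe (2 * Real.pi * (k + 1 / 4)) y
        - ∑ k ∈ Finset.range N, polePairRe (2 * Real.pi * (k + 3 / 4)) y : ℝ) : ℂ)
      - ((∑ k ∈ Finset.range (N + 1), polePairIm (2 * Real.pi * (k + 1 / 4)) y
        + ∑ k ∈ Finset.range N, polePairIm (2 * Real.pi * (k + 3 / 4)) y : ℝ) : ℂ)
        * Complex.I := by
    intro N
    have e1 : ∀ k : ℕ, 1 / (z + k) = Real.pi * ((polePairRe (2 * Real.pi * (k + 1 / 4)) y : ℝ)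
        - (polePairIm (2 * Real.pi * (k + 1 / 4)) y : ℝ) * Complex.I) := fun k => by
      rw [← one_div_add_mul_I _ _ (by positivity), hz]
      push_cast
      congr 1
      ring
    have e2 : ∀ k : ℕ, 1 / (z - (k + 1)) = Real.pi *
        (-(polePairRe (2 * Real.pi * (k + 3 / 4)) y : ℝ)
        - (polePairIm (2 * Real.pi * (k + 3 / 4)) y : ℝ) * Complex.I) := fun k => by
      have h := one_div_add_mul_I (k + 3 / 4) (-y) (by positivity)
      have hre : polePairRe (2 * Real.pi * (k + 3 / 4)) (-y)
        = polePairRe (2 * Real.pi * (k + 3 / 4)) y := by simp [polePairRe]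
      have him : polePairIm (2 * Real.pi * (k + 3 / 4)) (-y)
        = -polePairIm (2 * Real.pi * (k + 3 / 4)) y := by simp [polePairIm, neg_div]
      rw [hre, him] at h
      rw [show z - (k + 1) = -(((k + 3 / 4 : ℝ) : ℂ) + ((-y : ℝ) : ℂ) / (2 * Real.pi) * Complex.I)
        by rw [hz]; push_cast; ring, one_div_neg_eq_neg_one_div, h]
      push_cast
      ring
    simp only [e1, e2, ← Finset.mul_sum, Finset.sum_sub_distrib, Finset.sum_neg_distrib,
      ← Finset.sum_mul]
    push_cast
    rw [← mul_add, inv_mul_cancel_left₀ hpi']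
    ring
  simp only [key] at h
  constructor
  · have := (Complex.continuous_re.tendsto _).comp h
    simpa [Function.comp_def, -Complex.ofReal_sub, -Complex.ofReal_add, -Complex.ofReal_sum,
      -Complex.ofReal_div, -Complex.ofReal_tanh, -Complex.ofReal_inv] using this
  · have := ((Complex.continuous_im.tendsto _).comp h).neg
    simpa [Function.comp_def, -Complex.ofReal_sub, -Complex.ofReal_add, -Complex.ofReal_sum,
      -Complex.ofReal_div, -Complex.ofReal_tanh, -Complex.ofReal_inv, -neg_add_rev] using this

/-- The symmetrized Hilbert kernel applied to `polePairRe a`; see `polePairRe_sub_div`. -/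
noncomputable def poleKernel (a x u : ℝ) : ℝ :=
  8 * a * x / ((a ^ 2 + (u - x) ^ 2) * (a ^ 2 + (u + x) ^ 2))

theorem polePairRe_sub_div {a u : ℝ} (ha : 0 < a) (hu : u ≠ 0) (x : ℝ) :
    (polePairRe a (x - u) - polePairRe a (x + u)) / u = poleKernel a x u := by
  unfold polePairRe poleKernel
  have h1 : a ^ 2 + (x - u) ^ 2 ≠ 0 := by positivity
  have h2 : a ^ 2 + (x + u) ^ 2 ≠ 0 := by positivity
  have h3 : a ^ 2 + (u - x) ^ 2 ≠ 0 := by positivity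
  have h4 : a ^ 2 + (u + x) ^ 2 ≠ 0 := by positivity
  rw [div_sub_div _ _ h1 h2, div_div, div_eq_div_iff (by positivity) (by positivity)]
  ring

theorem hasDerivAt_poleKernel_primitive {a : ℝ} (ha : 0 < a) (x u : ℝ) :
    HasDerivAt (fun u => (a * (Real.log (a ^ 2 + (u + x) ^ 2) - Real.log (a ^ 2 + (u - x) ^ 2))
      + 2 * x * (Real.arctan ((u + x) / a) + Real.arctan ((u - x) / a))) / (a ^ 2 + x ^ 2))
      (poleKernel a x u) u := by
  have h1 : a ^ 2 + (u - x) ^ 2 ≠ 0 := by positivity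
  have h2 : a ^ 2 + (u + x) ^ 2 ≠ 0 := by positivity
  have h3 : a ^ 2 + x ^ 2 ≠ 0 := by positivity
  have hp : HasDerivAt (fun u => u + x) 1 u := (hasDerivAt_id u).add_const x
  have hm : HasDerivAt (fun u => u - x) 1 u := (hasDerivAt_id u).sub_const x
  have := ((((((hp.pow 2).const_add (a ^ 2)).log h2).sub
    (((hm.pow 2).const_add (a ^ 2)).log h1)).const_mul a).add
    ((((hp.div_const a).arctan).add ((hm.div_const a).arctan)).const_mul (2 * x))).div_const
    (a ^ 2 + x ^ 2)
  refine this.congr_deriv ?_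
  have e1 : 1 + ((u + x) / a) ^ 2 = (a ^ 2 + (u + x) ^ 2) / a ^ 2 := by field_simp
  have e2 : 1 + ((u - x) / a) ^ 2 = (a ^ 2 + (u - x) ^ 2) / a ^ 2 := by field_simp
  simp only [Pi.pow_apply]
  rw [e1, e2, poleKernel, div_eq_iff h3]
  field_simp
  ring

theorem tendsto_poleKernel_primitive {a : ℝ} (ha : 0 < a) (x : ℝ) :
    Tendsto (fun u => (a * (Real.log (a ^ 2 + (u + x) ^ 2) - Real.log (a ^ 2 + (u - x) ^ 2))
      + 2 * x * (Real.arctan ((u + x) / a) + Real.arctan ((u - x) / a))) / (a ^ 2 + x ^ 2))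
      atTop (𝓝 (Real.pi * polePairIm a x)) := by
  have hlog : Tendsto (fun u => Real.log (a ^ 2 + (u + x) ^ 2) - Real.log (a ^ 2 + (u - x) ^ 2))
      atTop (𝓝 0) := by
    have hc : ContinuousAt (fun v : ℝ => Real.log (((a * v) ^ 2 + (1 + x * v) ^ 2) /
        ((a * v) ^ 2 + (1 - x * v) ^ 2))) 0 := by
      refine ContinuousAt.log (ContinuousAt.div (by fun_prop) (by fun_prop) ?_) ?_ <;> simp
    have := hc.tendsto.comp tendsto_inv_atTop_zero
    simp only [mul_zero, add_zero, sub_zero, ne_eq, OfNat.ofNat_ne_zero, not_false_eq_true,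
      zero_pow, one_pow, zero_add, div_one, Real.log_one] at this
    refine this.congr' ?_
    filter_upwards [eventually_gt_atTop 0] with u hu
    have h1 : a ^ 2 + (u - x) ^ 2 ≠ 0 := by positivity
    have h2 : a ^ 2 + (u + x) ^ 2 ≠ 0 := by positivity
    rw [Function.comp_apply, ← Real.log_div h2 h1]
    congr 1
    have e1 : (a * u⁻¹) ^ 2 + (1 + x * u⁻¹) ^ 2 = (a ^ 2 + (u + x) ^ 2) / u ^ 2 := by field_simp
    have e2 : (a * u⁻¹) ^ 2 + (1 - x * u⁻¹) ^ 2 = (a ^ 2 + (u - x) ^ 2) / u ^ 2 := by field_simp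
    rw [e1, e2, div_div_div_cancel_right₀ (by positivity)]
  have harc : ∀ c : ℝ, Tendsto (fun u => Real.arctan ((u + c) / a)) atTop (𝓝 (Real.pi / 2)) :=
    fun c => (Real.tendsto_arctan_atTop.mono_right nhdsWithin_le_nhds).comp
      ((tendsto_atTop_add_const_right _ c tendsto_id).atTop_div_const ha)
  have := ((hlog.const_mul a).add
    (((harc x).add (harc (-x))).const_mul (2 * x))).div_const (a ^ 2 + x ^ 2)
  simp only [← sub_eq_add_neg] at this
  convert this using 2
  rw [polePairIm]
  ring

theorem integrableOn_poleKernel_and_integral {a : ℝ} (ha : 0 < a) (x : ℝ) :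
    IntegrableOn (poleKernel a x) (Ioi 0) ∧
      ∫ u in Ioi 0, poleKernel a x u = Real.pi * polePairIm a x ∧
      ∫ u in Ioi 0, ‖poleKernel a x u‖ = Real.pi * polePairIm a |x| := by
  wlog hx : 0 ≤ x generalizing x
  · obtain ⟨h1, h2, h3⟩ := this (-x) (by linarith)
    have hn : poleKernel a x = fun u => -poleKernel a (-x) u := by
      ext u
      simp only [poleKernel, sub_neg_eq_add, mul_neg, neg_div, neg_neg, ← sub_eq_add_neg]
      rw [mul_comm (a ^ 2 + (u - x) ^ 2)]
    rw [hn]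
    refine ⟨h1.neg, ?_, ?_⟩
    · rw [integral_neg, h2]
      simp [polePairIm, neg_div]
    · simpa only [norm_neg, abs_neg] using h3
  have hpos : ∀ u, 0 ≤ poleKernel a x u := fun u => by
    unfold poleKernel
    positivity
  have hd := fun (u : ℝ) (_ : u ∈ Ici (0 : ℝ)) => hasDerivAt_poleKernel_primitive ha x u
  have h_int := integrableOn_Ioi_deriv_of_nonneg' hd (fun u _ => hpos u)
    (tendsto_poleKernel_primitive ha x)
  have hval := integral_Ioi_of_hasDerivAt_of_nonneg' hd (fun u _ => hpos u)
    (tendsto_poleKernel_primitive ha x)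
  have hzero : (a * (Real.log (a ^ 2 + (0 + x) ^ 2) - Real.log (a ^ 2 + (0 - x) ^ 2))
      + 2 * x * (Real.arctan ((0 + x) / a) + Real.arctan ((0 - x) / a))) / (a ^ 2 + x ^ 2) = 0 := by
    simp [neg_div, Real.arctan_neg]
  rw [hzero, sub_zero] at hval
  refine ⟨h_int, hval, ?_⟩
  simp_rw [Real.norm_of_nonneg (hpos _), abs_of_nonneg hx, hval]

theorem add_one_le_two_pi_mul {c : ℝ} (hc : 1 / 4 ≤ c) (k : ℕ) :
    (k : ℝ) + 1 ≤ 2 * Real.pi * (k + c) := by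
  have h := Real.pi_gt_three
  have hk : (0 : ℝ) ≤ k := k.cast_nonneg
  nlinarith [mul_nonneg hk (by linarith : 0 ≤ Real.pi - 3),
    mul_nonneg (by linarith : 0 ≤ c) (by linarith : 0 ≤ Real.pi - 3)]

theorem summable_one_div_succ_sq (C : ℝ) : Summable fun k : ℕ => C * (1 / ((k : ℝ) + 1) ^ 2) := by
  have := (summable_nat_add_iff 1).2 (Real.summable_one_div_nat_pow.2 one_lt_two)
  exact Summable.mul_left C (by simpa using this)

theorem summable_polePairIm {c : ℝ} (hc : 1 / 4 ≤ c) (x : ℝ) :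
    Summable fun k : ℕ => polePairIm (2 * Real.pi * (k + c)) x := by
  refine Summable.of_norm_bounded (summable_one_div_succ_sq (2 * |x|)) fun k => ?_
  have h := add_one_le_two_pi_mul hc k
  set a := 2 * Real.pi * (k + c)
  have hk : (0 : ℝ) < k + 1 := by positivity
  rw [polePairIm, norm_div, norm_mul, Real.norm_eq_abs x, Real.norm_of_nonneg zero_le_two,
    Real.norm_of_nonneg (by positivity), mul_one_div]
  refine div_le_div_of_nonneg_left (by positivity) (by positivity) ?_
  nlinarith [sq_nonneg x]

theorem summable_poleKernel {c : ℝ} (hc : 1 / 4 ≤ c) (x u : ℝ) :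
    Summable fun k : ℕ => poleKernel (2 * Real.pi * (k + c)) x u := by
  refine Summable.of_norm_bounded (summable_one_div_succ_sq (8 * |x|)) fun k => ?_
  have h := add_one_le_two_pi_mul hc k
  set a := 2 * Real.pi * (k + c)
  have hk : (0 : ℝ) < k + 1 := by positivity
  have hk0 : (0 : ℝ) ≤ k := k.cast_nonneg
  have ha : 1 ≤ a := by linarith
  have ha0 : 0 < a := by linarith
  rw [poleKernel, norm_div, norm_mul, Real.norm_eq_abs x, Real.norm_of_nonneg (by positivity),
    Real.norm_of_nonneg (by positivity), mul_one_div, div_le_div_iff₀ (by positivity)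
    (by positivity)]
  have h1 : a * (k + 1) ^ 2 ≤ (a ^ 2 + (u - x) ^ 2) * (a ^ 2 + (u + x) ^ 2) := by
    have h2 : a * (k + 1) ^ 2 ≤ a ^ 2 * a ^ 2 := by
      apply mul_le_mul <;> nlinarith
    refine h2.trans ?_
    gcongr <;> nlinarith [sq_nonneg (u - x), sq_nonneg (u + x)]
  calc 8 * a * |x| * (k + 1) ^ 2 = 8 * |x| * (a * (k + 1) ^ 2) := by ring
    _ ≤ _ := by gcongr

theorem integrable_one_div_cosh : Integrable fun y : ℝ => 1 / Real.cosh y := by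
  refine (integrable_inv_one_add_sq.const_mul 4).mono'
    (Continuous.aestronglyMeasurable ?_) (Eventually.of_forall fun y => ?_)
  · exact continuous_const.div Real.continuous_cosh fun y => (Real.cosh_pos y).ne'
  · rw [Real.norm_of_nonneg (by have := Real.cosh_pos y; positivity), ← div_eq_mul_inv,
      div_le_div_iff₀ (Real.cosh_pos y) (by positivity)]
    have h1 := Real.quadratic_le_exp_of_nonneg (abs_nonneg y)
    have h2 := Real.cosh_eq |y|
    rw [Real.cosh_abs] at h2
    rw [sq_abs] at h1
    linarith [abs_nonneg y, Real.exp_pos (-|y|)]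

/-- The even symmetrization, with respect to `y ↦ 2 x - y`, of `sech y / (x - y)`. -/
noncomputable def sechKernel (x u : ℝ) : ℝ :=
  (1 / Real.cosh (x - u) - 1 / Real.cosh (x + u)) / u

theorem norm_sechKernel_le (x : ℝ) {u : ℝ} (hu : 0 < u) :
    ‖sechKernel x u‖ ≤ 2 * |Real.sinh x| * (1 / Real.cosh u) := by
  have h1 := Real.cosh_pos (x - u)
  have h2 := Real.cosh_pos (x + u)
  have h3 := Real.cosh_pos u
  have hprod : Real.cosh (x - u) * Real.cosh (x + u) = Real.cosh u ^ 2 + Real.sinh x ^ 2 := by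
    rw [Real.cosh_sub, Real.cosh_add]
    linear_combination Real.cosh u ^ 2 * Real.cosh_sq x + Real.sinh x ^ 2 * Real.cosh_sq u
  have hs : Real.sinh u ≤ u * Real.cosh u := by
    obtain ⟨c, hc, hcs⟩ := exists_deriv_eq_slope Real.sinh hu Real.continuous_sinh.continuousOn
      Real.differentiable_sinh.differentiableOn
    rw [Real.deriv_sinh, Real.sinh_zero, sub_zero, sub_zero, eq_div_iff hu.ne', mul_comm] at hcs
    rw [← hcs]
    have : Real.cosh c ≤ Real.cosh u := by
      rw [Real.cosh_le_cosh, abs_of_pos hc.1, abs_of_pos hu]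
      exact hc.2.le
    gcongr
  have heq : sechKernel x u
      = 2 * Real.sinh x * Real.sinh u / ((Real.cosh u ^ 2 + Real.sinh x ^ 2) * u) := by
    rw [sechKernel, div_sub_div _ _ h1.ne' h2.ne', hprod, div_div]
    congr 1
    rw [Real.cosh_sub, Real.cosh_add]
    ring
  have hsu : 0 ≤ Real.sinh u := Real.sinh_nonneg_iff.2 hu.le
  have hD : 0 < (Real.cosh u ^ 2 + Real.sinh x ^ 2) * u := by positivity
  rw [heq, norm_div, Real.norm_of_nonneg hD.le, norm_mul, norm_mul,
    Real.norm_of_nonneg zero_le_two, Real.norm_of_nonneg hsu, Real.norm_eq_abs, mul_one_div,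
    div_le_div_iff₀ hD h3, mul_assoc _ (Real.sinh u)]
  refine mul_le_mul_of_nonneg_left ?_ (by positivity)
  calc Real.sinh u * Real.cosh u ≤ u * Real.cosh u * Real.cosh u := by gcongr
    _ ≤ (Real.cosh u ^ 2 + Real.sinh x ^ 2) * u := by nlinarith [sq_nonneg (Real.sinh x)]

theorem integrableOn_sechKernel (x : ℝ) : IntegrableOn (sechKernel x) (Ioi 0) := by
  refine ((integrable_one_div_cosh.const_mul (2 * |Real.sinh x|)).integrableOn).mono' ?_ ?_
  · have h : Measurable (sechKernel x) := by
      unfold sechKernel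
      fun_prop
    exact h.aestronglyMeasurable
  · exact (ae_restrict_mem measurableSet_Ioi).mono fun u hu => norm_sechKernel_le x hu

theorem sechKernel_eq_tsum (x : ℝ) {u : ℝ} (hu : 0 < u) :
    sechKernel x u = ∑' k : ℕ, (poleKernel (2 * Real.pi * (k + 1 / 4)) x u
      - poleKernel (2 * Real.pi * (k + 3 / 4)) x u) := by
  have hA := summable_poleKernel (c := 1 / 4) le_rfl x u
  have hB := summable_poleKernel (c := 3 / 4) (by norm_num) x u
  rw [hA.tsum_sub hB]
  refine tendsto_nhds_unique
    (((tendsto_sum_polePair (x - u)).1.sub (tendsto_sum_polePair (x + u)).1).div_const u) ?_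
  refine (((tendsto_add_atTop_iff_nat 1).2 hA.hasSum.tendsto_sum_nat).sub
    hB.hasSum.tendsto_sum_nat).congr fun N => ?_
  have e : ∀ c : ℝ, 0 < c → ∀ k : ℕ, poleKernel (2 * Real.pi * (k + c)) x u =
      (polePairRe (2 * Real.pi * (k + c)) (x - u) - polePairRe (2 * Real.pi * (k + c)) (x + u)) / u :=
    fun c hc k => (polePairRe_sub_div (by positivity) hu.ne' x).symm
  simp only [e (1 / 4) (by norm_num), e (3 / 4) (by norm_num), ← Finset.sum_div,
    Finset.sum_sub_distrib]
  ring

theorem integral_sechKernel (x : ℝ) :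
    ∫ u in Ioi 0, sechKernel x u
      = Real.pi * (∑' k : ℕ, polePairIm (2 * Real.pi * (k + 1 / 4)) x
        - ∑' k : ℕ, polePairIm (2 * Real.pi * (k + 3 / 4)) x) := by
  have hA := fun k : ℕ => integrableOn_poleKernel_and_integral
    (a := 2 * Real.pi * (k + 1 / 4)) (by positivity) x
  have hB := fun k : ℕ => integrableOn_poleKernel_and_integral
    (a := 2 * Real.pi * (k + 3 / 4)) (by positivity) x
  have h14 : (1 / 4 : ℝ) ≤ 3 / 4 := by norm_num
  have hsum := hasSum_integral_of_summable_integral_norm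
    (F := fun (k : ℕ) u => poleKernel (2 * Real.pi * (k + 1 / 4)) x u
      - poleKernel (2 * Real.pi * (k + 3 / 4)) x u) (μ := volume.restrict (Ioi 0))
    (fun k => (hA k).1.sub (hB k).1) ?_
  · rw [setIntegral_congr_fun measurableSet_Ioi fun u hu => sechKernel_eq_tsum x hu,
      ← hsum.tsum_eq, ← (summable_polePairIm le_rfl x).tsum_sub (summable_polePairIm h14 x),
      ← tsum_mul_left]
    congr 1
    ext k
    rw [integral_sub (hA k).1 (hB k).1, (hA k).2.1, (hB k).2.1, mul_sub]
  · refine Summable.of_nonneg_of_le (fun k => integral_nonneg fun u => norm_nonneg _) (fun k => ?_)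
      (((summable_polePairIm le_rfl |x|).mul_left Real.pi).add
        ((summable_polePairIm h14 |x|).mul_left Real.pi))
    rw [← (hA k).2.2, ← (hB k).2.2, ← integral_add (hA k).1.norm (hB k).1.norm]
    exact integral_mono ((hA k).1.sub (hB k).1).norm ((hA k).1.norm.add (hB k).1.norm)
      fun u => norm_sub_le _ _

theorem integral_sech_div_sub (x : ℝ) {ε : ℝ} (hε : 0 < ε) :
    ∫ y in {y : ℝ | ε < |y - x|}, (1 / Real.cosh y) / (x - y) = ∫ u in Ioi ε, sechKernel x u := by
  set h : ℝ → ℝ := fun y => (1 / Real.cosh y) / (x - y) with hh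
  have hset : {y : ℝ | ε < |y - x|} = Iio (x - ε) ∪ Ioi (x + ε) := by
    ext y
    simp only [mem_ofPred_eq, lt_abs, mem_union, mem_Iio, mem_Ioi]
    constructor <;> rintro (h | h) <;> [right; left; right; left] <;> linarith
  have hmeas : MeasurableSet {y : ℝ | ε < |y - x|} := by
    rw [hset]
    exact measurableSet_Iio.union measurableSet_Ioi
  have h_int : IntegrableOn h {y : ℝ | ε < |y - x|} := by
    refine ((integrable_one_div_cosh.const_mul (1 / ε)).integrableOn).mono' ?_ ?_
    · have hm : Measurable h := by
        rw [hh]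
        fun_prop
      exact hm.aestronglyMeasurable
    · refine (ae_restrict_mem hmeas).mono fun y hy => ?_
      have hy' : ε < |x - y| := by rw [abs_sub_comm]; exact hy
      have hc := Real.cosh_pos y
      rw [hh, norm_div, Real.norm_of_nonneg (by positivity), Real.norm_eq_abs, mul_comm,
        mul_one_div]
      gcongr
  rw [hset] at h_int ⊢
  have hl := h_int.left_of_union
  have hr := h_int.right_of_union
  have mpl : MeasurePreserving (fun u : ℝ => x - u) volume volume :=
    Measure.measurePreserving_sub_left volume x
  have mpr : MeasurePreserving (fun u : ℝ => x + u) volume volume :=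
    measurePreserving_add_left volume x
  have mel : MeasurableEmbedding (fun u : ℝ => x - u) :=
    (Homeomorph.subLeft x).measurableEmbedding
  have mer : MeasurableEmbedding (fun u : ℝ => x + u) := measurableEmbedding_addLeft x
  have pl : (fun u : ℝ => x - u) ⁻¹' Iio (x - ε) = Ioi ε := by ext; simp
  have pr : (fun u : ℝ => x + u) ⁻¹' Ioi (x + ε) = Ioi ε := by ext; simp
  rw [← mpl.integrableOn_comp_preimage mel, pl] at hl
  rw [← mpr.integrableOn_comp_preimage mer, pr] at hr
  replace hl : IntegrableOn (fun u => h (x - u)) (Ioi ε) := hl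
  replace hr : IntegrableOn (fun u => h (x + u)) (Ioi ε) := hr
  rw [setIntegral_union (disjoint_left.2 fun y h1 h2 => by
      simp only [mem_Iio, mem_Ioi] at h1 h2; linarith) measurableSet_Ioi
    h_int.left_of_union h_int.right_of_union,
    ← mpl.setIntegral_preimage_emb mel h (Iio (x - ε)),
    ← mpr.setIntegral_preimage_emb mer h (Ioi (x + ε)), pl, pr,
    ← integral_add hl hr]
  refine setIntegral_congr_fun measurableSet_Ioi fun u _ => ?_
  simp only [sechKernel, hh]
  ring

theorem tendsto_integral_sech_div_sub (x : ℝ) :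
    Tendsto (fun ε : ℝ => ∫ y in {y : ℝ | ε < |y - x|}, (1 / Real.cosh y) / (x - y))
      (𝓝[>] 0) (𝓝 (∫ u in Ioi 0, sechKernel x u)) := by
  have h := (aecover_Ioi_of_Ioi (μ := volume) (a := fun ε : ℝ => ε)
    (tendsto_id.mono_left nhdsWithin_le_nhds :
      Tendsto id (𝓝[>] (0 : ℝ)) (𝓝 0))).integral_tendsto_of_countably_generated
    (integrableOn_sechKernel x)
  refine h.congr' ?_
  filter_upwards [self_mem_nhdsWithin] with ε hε
  rw [integral_sech_div_sub x hε, Measure.restrict_restrict measurableSet_Ioi,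
    inter_eq_self_of_subset_left (Ioi_subset_Ioi (le_of_lt hε))]

theorem digamma_sub_digamma_conj (x : ℝ) :
    digamma (1 / 4 + Complex.I * x / (2 * Real.pi))
      - digamma (1 / 4 - Complex.I * x / (2 * Real.pi))
      = 2 * Real.pi * Complex.I *
        ((∑' k : ℕ, polePairIm (2 * Real.pi * (k + 1 / 4)) x : ℝ) : ℂ) := by
  have hre : ∀ y : ℝ, (1 / 4 + y / (2 * Real.pi) * Complex.I : ℂ).re = 1 / 4 := fun y => by
    rw [Complex.add_re, Complex.mul_I_re, im_ofReal_div_two_pi]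
    norm_num
  have hlim : ∀ y : ℝ, Tendsto (fun n : ℕ => Complex.log n
      - ∑ k ∈ Finset.range (n + 1), (Real.pi * ((polePairRe (2 * Real.pi * (k + 1 / 4)) y : ℝ)
        - (polePairIm (2 * Real.pi * (k + 1 / 4)) y : ℝ) * Complex.I) : ℂ)) atTop
      (𝓝 (digamma (1 / 4 + y / (2 * Real.pi) * Complex.I))) := fun y => by
    refine (tendsto_log_sub_sum_digamma (by rw [hre]; norm_num)).congr fun n => ?_
    congr 1
    refine Finset.sum_congr rfl fun k _ => ?_
    rw [← one_div_add_mul_I _ _ (by positivity)]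
    push_cast
    congr 1
    ring
  have h := (hlim x).sub (hlim (-x))
  have hs : Tendsto (fun n : ℕ => 2 * Real.pi * Complex.I *
      ((∑ k ∈ Finset.range (n + 1), polePairIm (2 * Real.pi * (k + 1 / 4)) x : ℝ) : ℂ)) atTop
      (𝓝 (2 * Real.pi * Complex.I *
        ((∑' k : ℕ, polePairIm (2 * Real.pi * (k + 1 / 4)) x : ℝ) : ℂ))) :=
    (((Complex.continuous_ofReal.tendsto _).comp ((tendsto_add_atTop_iff_nat 1).2
      (summable_polePairIm le_rfl x).hasSum.tendsto_sum_nat))).const_mul _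
  rw [show (1 / 4 + Complex.I * x / (2 * Real.pi) : ℂ)
      = 1 / 4 + x / (2 * Real.pi) * Complex.I by ring,
    show (1 / 4 - Complex.I * x / (2 * Real.pi) : ℂ)
      = 1 / 4 + (-x : ℝ) / (2 * Real.pi) * Complex.I by push_cast; ring]
  refine tendsto_nhds_unique h (hs.congr fun n => ?_)
  have hreneg : ∀ a, polePairRe a (-x) = polePairRe a x := fun a => by simp [polePairRe]
  have himneg : ∀ a, polePairIm a (-x) = -polePairIm a x := fun a => by
    simp [polePairIm, neg_div]
  simp only [hreneg, himneg]
  rw [sub_sub_sub_cancel_left, ← Finset.sum_sub_distrib, Complex.ofReal_sum, Finset.mul_sum]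
  refine Finset.sum_congr rfl fun k _ => ?_
  push_cast
  ring

/-- For every `x ∈ ℝ`, the principal value `PV∫_ℝ sech(y)/(x−y) dy`
exists and equals `−π·tanh(x) − i·(ψ(1/4 + ix/(2π)) − ψ(1/4 − ix/(2π)))`; in
particular this right-hand side is real, since the two digamma values are complex
conjugates of each other. -/
theorem pv_sech_digamma (x : ℝ) :
    ∃ L : ℝ,
      Tendsto
        (fun ε : ℝ => ∫ y in {y : ℝ | ε < |y - x|}, (1 / Real.cosh y) / (x - y))
        (𝓝[>] 0) (𝓝 L)
      ∧ (L : ℂ) = -((Real.pi : ℂ) * Complex.tanh (x : ℂ))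
          - Complex.I * (digamma (1 / 4 + Complex.I * (x : ℂ) / (2 * (Real.pi : ℂ)))
            - digamma (1 / 4 - Complex.I * (x : ℂ) / (2 * (Real.pi : ℂ))))
      ∧ digamma (1 / 4 - Complex.I * (x : ℂ) / (2 * (Real.pi : ℂ)))
          = starRingEnd ℂ (digamma (1 / 4 + Complex.I * (x : ℂ) / (2 * (Real.pi : ℂ)))) := by
  have htanh : Real.tanh x = ∑' k : ℕ, polePairIm (2 * Real.pi * (k + 1 / 4)) x
      + ∑' k : ℕ, polePairIm (2 * Real.pi * (k + 3 / 4)) x :=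
    tendsto_nhds_unique (tendsto_sum_polePair x).2
      (((tendsto_add_atTop_iff_nat 1).2
        (summable_polePairIm le_rfl x).hasSum.tendsto_sum_nat).add
        (summable_polePairIm (by norm_num) x).hasSum.tendsto_sum_nat)
  refine ⟨_, tendsto_integral_sech_div_sub x, ?_, ?_⟩
  · rw [digamma_sub_digamma_conj, integral_sechKernel, ← Complex.ofReal_tanh, htanh]
    push_cast
    linear_combination (2 * (Real.pi : ℂ) *
      (∑' k : ℕ, (polePairIm (2 * Real.pi * (k + 1 / 4)) x : ℂ))) * Complex.I_sq
  · rw [← digamma_conj]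
    · congr 1
      simp [sub_eq_add_neg, neg_div, Complex.conj_ofNat]
    · have := im_ofReal_div_two_pi x
      rw [mul_div_assoc, Complex.add_re, Complex.I_mul_re, this]
      norm_num
end

section
/- For every x ∈ ℝ, the principal value PV∫_ℝ (sin(y)/(1 + y²))·(1/(x−y)) dy exists and equals π·(e^{−1} − cos(x))/(1 + x²). -/
open MeasureTheory Filter Set Topology

theorem hasDerivAt_pv_primitive (x y : ℝ) (h : y ≠ x) :
    HasDerivAt (fun y => (Real.log (((x - y)⁻¹) ^ 2 + (x * (x - y)⁻¹ - 1) ^ 2) / 2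
      + x * Real.arctan y) / (1 + x ^ 2)) ((1 + y ^ 2)⁻¹ * (x - y)⁻¹) y := by
  have hxy : x - y ≠ 0 := sub_ne_zero.mpr h.symm
  have h1 : (0 : ℝ) < 1 + y ^ 2 := by positivity
  have h2 : (0 : ℝ) < 1 + x ^ 2 := by positivity
  have he : ((x - y)⁻¹) ^ 2 + (x * (x - y)⁻¹ - 1) ^ 2 = (1 + y ^ 2) / (x - y) ^ 2 := by
    field_simp
    ring
  have hu : HasDerivAt (fun y : ℝ => (x - y)⁻¹) (((x - y) ^ 2)⁻¹) y := by
    refine (((hasDerivAt_id y).const_sub x).inv hxy).congr_deriv ?_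
    simp only [neg_neg, one_div, id]
  have hne : ((x - y)⁻¹) ^ 2 + (x * (x - y)⁻¹ - 1) ^ 2 ≠ 0 := by rw [he]; positivity
  have := (((((hu.pow 2).add (((hu.const_mul x).sub_const 1).pow 2)).log hne).div_const 2).add
    ((Real.hasDerivAt_arctan y).const_mul x)).div_const (1 + x ^ 2)
  refine this.congr_deriv ?_
  simp only [Pi.add_apply, Pi.pow_apply, Nat.cast_ofNat, Nat.add_one_sub_one, pow_one]
  rw [he]
  field_simp
  ring

theorem tendsto_pv_primitive (x : ℝ) {l : Filter ℝ} {a : ℝ}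
    (hu : Tendsto (fun y => (x - y)⁻¹) l (𝓝 0)) (ha : Tendsto Real.arctan l (𝓝 a)) :
    Tendsto (fun y => (Real.log (((x - y)⁻¹) ^ 2 + (x * (x - y)⁻¹ - 1) ^ 2) / 2
      + x * Real.arctan y) / (1 + x ^ 2)) l (𝓝 (x * a / (1 + x ^ 2))) := by
  have h : Tendsto (fun y => ((x - y)⁻¹) ^ 2 + (x * (x - y)⁻¹ - 1) ^ 2) l (𝓝 1) := by
    simpa using (hu.pow 2).add (((hu.const_mul x).sub_const 1).pow 2)
  simpa using (((h.log one_ne_zero).div_const 2).add (ha.const_mul x)).div_const (1 + x ^ 2)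

theorem setOf_lt_abs_sub (x ε : ℝ) : {y : ℝ | ε < |y - x|} = Iio (x - ε) ∪ Ioi (x + ε) := by
  ext y
  simp only [mem_ofPred_eq, mem_union, mem_Iio, mem_Ioi, lt_abs]
  constructor <;> rintro (h | h) <;> first | (left; linarith) | (right; linarith)

theorem measurableSet_lt_abs_sub (x ε : ℝ) : MeasurableSet {y : ℝ | ε < |y - x|} := by
  rw [setOf_lt_abs_sub]; measurability

theorem integrableOn_lorentzian_div_sub (x : ℝ) {ε : ℝ} (hε : 0 < ε) :
    IntegrableOn (fun y => (1 + y ^ 2)⁻¹ * (x - y)⁻¹) {y : ℝ | ε < |y - x|} := by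
  refine Integrable.mono' (integrable_inv_one_add_sq.mul_const ε⁻¹).integrableOn
    (by fun_prop) ?_
  filter_upwards [ae_restrict_mem (measurableSet_lt_abs_sub x ε)] with y hy
  have hy' : ε ≤ |x - y| := by rw [abs_sub_comm]; exact le_of_lt hy
  rw [norm_mul, norm_inv, norm_inv, Real.norm_eq_abs, Real.norm_eq_abs,
    abs_of_pos (by positivity : (0 : ℝ) < 1 + y ^ 2)]
  gcongr

/-- The principal value of `∫ (1 + y ^ 2)⁻¹ * (x - y)⁻¹ dy` is `π * x / (1 + x ^ 2)`. -/
theorem pv_lorentzian (x : ℝ) :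
    Tendsto (fun ε : ℝ => ∫ y in {y : ℝ | ε < |y - x|}, (1 + y ^ 2)⁻¹ * (x - y)⁻¹)
      (𝓝[>] 0) (𝓝 (Real.pi * x / (1 + x ^ 2))) := by
  set A : ℝ → ℝ := fun ε => (Real.log (1 + (x - ε) ^ 2) / 2 + x * Real.arctan (x - ε)) with hA
  have key : ∀ ε : ℝ, 0 < ε → ∫ y in {y : ℝ | ε < |y - x|}, (1 + y ^ 2)⁻¹ * (x - y)⁻¹
      = (Real.pi * x + A ε - A (-ε)) / (1 + x ^ 2) := by
    intro ε hε
    have hint := integrableOn_lorentzian_div_sub x hε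
    rw [setOf_lt_abs_sub] at hint ⊢
    rw [setIntegral_union (Set.disjoint_left.mpr fun y h1 h2 => by
      simp only [mem_Iio, mem_Ioi] at h1 h2; linarith) measurableSet_Ioi hint.left_of_union
      hint.right_of_union, ← integral_Iic_eq_integral_Iio,
      integral_Ioi_of_hasDerivAt_of_tendsto'
        (fun y hy => hasDerivAt_pv_primitive x y (by simp only [mem_Ici] at hy; linarith))
        hint.right_of_union
        (tendsto_pv_primitive x (tendsto_inv_atBot_zero.comp
          (tendsto_atBot_add_const_left _ x tendsto_neg_atTop_atBot))
          (tendsto_nhds_of_tendsto_nhdsWithin Real.tendsto_arctan_atTop)),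
      integral_Iic_of_hasDerivAt_of_tendsto'
        (a := x - ε)
        (fun y hy => hasDerivAt_pv_primitive x y (by simp only [mem_Iic] at hy; linarith))
        ((integrableOn_Iic_iff_integrableOn_Iio (b := x - ε) (by finiteness)).mpr hint.left_of_union)
        (tendsto_pv_primitive x (tendsto_inv_atTop_zero.comp
          (tendsto_atTop_add_const_left _ x tendsto_neg_atBot_atTop))
          (tendsto_nhds_of_tendsto_nhdsWithin Real.tendsto_arctan_atBot))]
    have e : ∀ δ : ℝ, δ ≠ 0 → Real.log (((x - (x - δ))⁻¹) ^ 2 + (x * (x - (x - δ))⁻¹ - 1) ^ 2)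
        = Real.log (1 + (x - δ) ^ 2) - Real.log (δ ^ 2) := by
      intro δ hδ
      rw [← Real.log_div (by positivity) (by positivity)]
      congr 1
      rw [sub_sub_cancel]
      field_simp
    have e2 := e (-ε) (by linarith)
    rw [e ε hε.ne', ← sub_neg_eq_add x ε, e2]
    simp only [hA, neg_sq]
    ring
  have hcont : Continuous A := by
    have : ∀ ε : ℝ, 1 + (x - ε) ^ 2 ≠ 0 := fun ε => by positivity
    fun_prop (disch := assumption)
  have hlim : Tendsto (fun ε => (Real.pi * x + A ε - A (-ε)) / (1 + x ^ 2)) (𝓝[>] 0)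
      (𝓝 ((Real.pi * x + A 0 - A (-0)) / (1 + x ^ 2))) :=
    (by fun_prop : Continuous fun ε =>
      (Real.pi * x + A ε - A (-ε)) / (1 + x ^ 2)).continuousAt.mono_left nhdsWithin_le_nhds
  rw [neg_zero, add_sub_cancel_right] at hlim
  refine hlim.congr' ?_
  filter_upwards [self_mem_nhdsWithin] with ε hε
  exact (key ε hε).symm

section
open scoped FourierTransform

theorem integrable_exp_neg_two_pi_abs :
    Integrable fun t : ℝ => (Real.exp (-(2 * Real.pi * |t|)) : ℂ) := by
  refine Integrable.ofReal (f := fun t : ℝ => Real.exp (-(2 * Real.pi * |t|))) ?_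
  rw [← integrableOn_univ, ← Iic_union_Ioi (a := (0 : ℝ))]
  refine IntegrableOn.union ?_ ?_
  · refine (integrableOn_exp_mul_Iic (a := 2 * Real.pi) (by positivity) 0).congr_fun
      (fun t ht => ?_) measurableSet_Iic
    simp only
    rw [abs_of_nonpos ht, mul_neg, neg_neg]
  · refine (integrableOn_exp_mul_Ioi (a := -(2 * Real.pi)) (by simp [Real.pi_pos]) 0).congr_fun
      (fun t ht => ?_) measurableSet_Ioi
    simp only
    rw [abs_of_pos ht, neg_mul]

theorem fourier_exp_neg_two_pi_abs (w : ℝ) :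
    𝓕 (fun t : ℝ => (Real.exp (-(2 * Real.pi * |t|)) : ℂ)) w
      = (((Real.pi)⁻¹ * (1 + w ^ 2)⁻¹ : ℝ) : ℂ) := by
  have hI (a : ℝ) : 1 + a * Complex.I ≠ 0 := fun h => by simpa using congrArg Complex.re h
  have hs : (1 : ℂ) + (w : ℂ) ^ 2 ≠ 0 := by exact_mod_cast (by positivity : 1 + w ^ 2 ≠ 0)
  have hm : (1 : ℂ) - w * Complex.I ≠ 0 := by simpa [sub_eq_add_neg] using hI (-w)
  have hpi : (Real.pi : ℂ) ≠ 0 := by exact_mod_cast Real.pi_ne_zero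
  have h1 : EqOn (fun t : ℝ => Complex.exp (2 * Real.pi * (1 - w * Complex.I) * t))
      (fun v : ℝ => Complex.exp (↑(-2 * Real.pi * inner ℝ v w) * Complex.I) •
        (Real.exp (-(2 * Real.pi * |v|)) : ℂ)) (Iic 0) := fun t ht => by
    simp only [RCLike.inner_apply, conj_trivial]
    rw [abs_of_nonpos ht, smul_eq_mul, Complex.ofReal_exp, ← Complex.exp_add]
    push_cast
    congr 1
    ring
  have h2 : EqOn (fun t : ℝ => Complex.exp (-(2 * Real.pi * (1 + w * Complex.I)) * t))
      (fun v : ℝ => Complex.exp (↑(-2 * Real.pi * inner ℝ v w) * Complex.I) •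
        (Real.exp (-(2 * Real.pi * |v|)) : ℂ)) (Ioi 0) := fun t ht => by
    simp only [RCLike.inner_apply, conj_trivial]
    rw [abs_of_pos ht, smul_eq_mul, Complex.ofReal_exp, ← Complex.exp_add]
    push_cast
    congr 1
    ring
  have ha : 0 < (2 * Real.pi * (1 - w * Complex.I) : ℂ).re := by simp [Real.pi_pos]
  have hb : (-(2 * Real.pi * (1 + w * Complex.I)) : ℂ).re < 0 := by simp [Real.pi_pos]
  rw [Real.fourier_eq', ← intervalIntegral.integral_Iic_add_Ioi
    ((integrableOn_exp_mul_complex_Iic ha 0).congr_fun h1 measurableSet_Iic)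
    ((integrableOn_exp_mul_complex_Ioi hb 0).congr_fun h2 measurableSet_Ioi),
    ← setIntegral_congr_fun measurableSet_Iic h1, ← setIntegral_congr_fun measurableSet_Ioi h2,
    integral_exp_mul_complex_Iic ha, integral_exp_mul_complex_Ioi hb]
  have hp := hI w
  simp only [Complex.ofReal_zero, mul_zero, Complex.exp_zero]
  push_cast
  field_simp
  linear_combination 2 * (w : ℂ) ^ 2 * Complex.I_sq

/-- The Fourier transform of the Lorentzian, obtained by Fourier inversion. -/
theorem integral_cexp_mul_lorentzian (s : ℝ) :
    ∫ y : ℝ, Complex.exp ((s * y : ℝ) * Complex.I) * (((1 + y ^ 2)⁻¹ : ℝ) : ℂ)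
      = (Real.pi * Real.exp (-|s|) : ℝ) := by
  have hF : 𝓕 (fun t : ℝ => (Real.exp (-(2 * Real.pi * |t|)) : ℂ))
      = fun w : ℝ => (((Real.pi)⁻¹ * (1 + w ^ 2)⁻¹ : ℝ) : ℂ) :=
    funext fourier_exp_neg_two_pi_abs
  have hpi : (Real.pi : ℂ) ≠ 0 := by exact_mod_cast Real.pi_ne_zero
  have h := congrFun (Continuous.fourierInv_fourier_eq
    (f := fun t : ℝ => (Real.exp (-(2 * Real.pi * |t|)) : ℂ)) (by fun_prop)
    integrable_exp_neg_two_pi_abs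
    (hF ▸ (integrable_inv_one_add_sq.const_mul _).ofReal)) (s / (2 * Real.pi))
  rw [hF, Real.fourierInv_eq'] at h
  have e : 2 * Real.pi * |s / (2 * Real.pi)| = |s| := by
    rw [abs_div, abs_of_pos Real.two_pi_pos]
    field_simp
  simp only [e] at h
  rw [Complex.ofReal_mul, ← h, ← integral_const_mul]
  congr 1
  ext y
  have e2 : 2 * Real.pi * inner ℝ y (s / (2 * Real.pi)) = s * y := by
    simp only [RCLike.inner_apply, conj_trivial]
    field_simp
  rw [e2, smul_eq_mul]
  push_cast
  field_simp
end

theorem integral_cos_add_mul_lorentzian (c s : ℝ) :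
    ∫ y : ℝ, Real.cos (c + s * y) * (1 + y ^ 2)⁻¹ = Real.pi * Real.exp (-|s|) * Real.cos c := by
  have h := congrArg (fun z => (Complex.exp (c * Complex.I) * z).re)
    (integral_cexp_mul_lorentzian s)
  have hint : Integrable fun y : ℝ => Complex.exp (c * Complex.I) *
      (Complex.exp ((s * y : ℝ) * Complex.I) * (((1 + y ^ 2)⁻¹ : ℝ) : ℂ)) := by
    refine Integrable.const_mul ((integrable_inv_one_add_sq.ofReal (𝕜 := ℂ)).bdd_mul (c := 1)
      (by fun_prop) (ae_of_all _ fun y => (Complex.norm_exp_ofReal_mul_I _).le)) _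
  beta_reduce at h
  rw [← integral_const_mul, ← RCLike.re_eq_complex_re, ← integral_re hint] at h
  have e (y : ℝ) : Complex.exp (c * Complex.I) *
      (Complex.exp ((s * y : ℝ) * Complex.I) * (((1 + y ^ 2)⁻¹ : ℝ) : ℂ))
      = Complex.exp ((c + s * y : ℝ) * Complex.I) * (((1 + y ^ 2)⁻¹ : ℝ) : ℂ) := by
    rw [← mul_assoc, ← Complex.exp_add]
    push_cast
    ring_nf
  simp only [e, RCLike.re_eq_complex_re, Complex.re_mul_ofReal, Complex.exp_ofReal_mul_I_re] at h
  rw [h, mul_comm]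

theorem integral_exp_neg_mul_cos (x : ℝ) :
    ∫ s in (0 : ℝ)..1, Real.exp (-s) * Real.cos ((1 - s) * x)
      = (Real.cos x + x * Real.sin x - Real.exp (-1)) / (1 + x ^ 2) := by
  have h : ∀ s : ℝ, HasDerivAt (fun s => -(Real.exp (-s) * (Real.cos ((1 - s) * x)
      + x * Real.sin ((1 - s) * x))) / (1 + x ^ 2))
      (Real.exp (-s) * Real.cos ((1 - s) * x)) s := by
    intro s
    have h1 : HasDerivAt (fun s : ℝ => (1 - s) * x) (-1 * x) s :=
      ((hasDerivAt_id s).const_sub 1).mul_const x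
    have := (((hasDerivAt_neg s).exp.mul (h1.cos.add (h1.sin.const_mul x))).neg).div_const
      (1 + x ^ 2)
    refine this.congr_deriv ?_
    simp only [Pi.add_apply]
    field_simp
    ring
  rw [intervalIntegral.integral_eq_sub_of_hasDerivAt (fun s _ => h s)
    (Continuous.intervalIntegrable (by fun_prop) _ _)]
  simp
  ring

theorem integral_cos_segment {x y : ℝ} (h : y ≠ x) :
    ∫ s in (0 : ℝ)..1, Real.cos ((1 - s) * x + s * y)
      = (Real.sin y - Real.sin x) / (y - x) := by
  have hd : ∀ s : ℝ, HasDerivAt (fun s => Real.sin ((1 - s) * x + s * y) / (y - x))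
      (Real.cos ((1 - s) * x + s * y)) s := by
    intro s
    have h1 : HasDerivAt (fun s : ℝ => (1 - s) * x + s * y) (-1 * x + 1 * y) s :=
      (((hasDerivAt_id s).const_sub 1).mul_const x).add ((hasDerivAt_id s).mul_const y)
    refine (h1.sin.div_const (y - x)).congr_deriv ?_
    have := sub_ne_zero.mpr h
    field_simp
    ring
  rw [intervalIntegral.integral_eq_sub_of_hasDerivAt (fun s _ => hd s)
    (Continuous.intervalIntegrable (by fun_prop) _ _)]
  simp
  ring

theorem integrable_prod_cos_segment (x : ℝ) :
    Integrable (Function.uncurry fun s y : ℝ => Real.cos ((1 - s) * x + s * y) * (1 + y ^ 2)⁻¹)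
      ((volume.restrict (uIoc 0 1)).prod volume) := by
  have : IsFiniteMeasure (volume.restrict (uIoc (0 : ℝ) 1)) := by
    rw [uIoc_of_le zero_le_one]
    infer_instance
  have : Integrable (fun p : ℝ × ℝ => (1 : ℝ) * (1 + p.2 ^ 2)⁻¹)
      ((volume.restrict (uIoc 0 1)).prod volume) :=
    (integrable_const (1 : ℝ)).mul_prod integrable_inv_one_add_sq
  refine this.mono' ?_ (ae_of_all _ fun p => ?_)
  · have : ∀ p : ℝ × ℝ, 1 + p.2 ^ 2 ≠ 0 := fun p => by positivity
    exact Continuous.aestronglyMeasurable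
      (by unfold Function.uncurry; fun_prop (disch := assumption))
  · simp only [Function.uncurry]
    rw [norm_mul, Real.norm_of_nonneg (by positivity : 0 ≤ (1 + p.2 ^ 2)⁻¹)]
    gcongr
    exact Real.abs_cos_le_one _

theorem integral_lorentzian_mul_cos_segment (x : ℝ) :
    ∫ y : ℝ, (∫ s in (0 : ℝ)..1, Real.cos ((1 - s) * x + s * y) * (1 + y ^ 2)⁻¹)
      = Real.pi * ((Real.cos x + x * Real.sin x - Real.exp (-1)) / (1 + x ^ 2)) := by
  rw [← intervalIntegral_integral_swap (integrable_prod_cos_segment x),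
    ← integral_exp_neg_mul_cos, ← intervalIntegral.integral_const_mul]
  refine intervalIntegral.integral_congr fun s hs => ?_
  rw [uIcc_of_le zero_le_one] at hs
  rw [integral_cos_add_mul_lorentzian, abs_of_nonneg hs.1, mul_assoc]

theorem aecover_lt_abs_sub (x : ℝ) :
    AECover volume (𝓝[>] (0 : ℝ)) fun ε => {y : ℝ | ε < |y - x|} where
  ae_eventually_mem := by
    filter_upwards [compl_mem_ae_iff.mpr (measure_singleton x)] with y hy
    exact nhdsWithin_le_nhds (gt_mem_nhds (abs_pos.mpr (sub_ne_zero.mpr hy)))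
  measurableSet ε := measurableSet_lt_abs_sub x ε

/-- For every `x ∈ ℝ`, the principal value
`PV∫_ℝ (sin(y)/(1 + y²))·(1/(x−y)) dy` exists and equals
`π·(e^{−1} − cos(x))/(1 + x²)`. -/
theorem pv_sin_lorentzian (x : ℝ) :
    Tendsto
      (fun ε : ℝ => ∫ y in {y : ℝ | ε < |y - x|},
        (Real.sin y / (1 + y ^ 2)) * (1 / (x - y)))
      (𝓝[>] 0)
      (𝓝 (Real.pi * (Real.exp (-1) - Real.cos x) / (1 + x ^ 2))) := by
  set K : ℝ → ℝ := fun y => ∫ s in (0 : ℝ)..1, Real.cos ((1 - s) * x + s * y) * (1 + y ^ 2)⁻¹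
    with hK
  have hKint : Integrable K := by
    have := (integrable_prod_cos_segment x).integral_prod_right
    simpa only [hK, Function.uncurry, intervalIntegral.integral_of_le zero_le_one,
      uIoc_of_le zero_le_one] using this
  have h := ((pv_lorentzian x).const_mul (Real.sin x)).sub
    ((aecover_lt_abs_sub x).integral_tendsto_of_countably_generated hKint)
  rw [hK, integral_lorentzian_mul_cos_segment] at h
  have hval : Real.sin x * (Real.pi * x / (1 + x ^ 2))
      - Real.pi * ((Real.cos x + x * Real.sin x - Real.exp (-1)) / (1 + x ^ 2))
      = Real.pi * (Real.exp (-1) - Real.cos x) / (1 + x ^ 2) := by ring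
  rw [hval] at h
  refine h.congr' ?_
  filter_upwards [self_mem_nhdsWithin] with ε hε
  rw [← integral_const_mul, ← integral_sub
    ((integrableOn_lorentzian_div_sub x hε).const_mul _) hKint.integrableOn]
  refine setIntegral_congr_fun (measurableSet_lt_abs_sub x ε) fun y hy => ?_
  have hyx : y ≠ x := by
    rintro rfl
    simp only [mem_ofPred_eq, sub_self, abs_zero] at hy
    exact lt_asymm hy hε
  have h1 := sub_ne_zero.mpr hyx
  have h2 := sub_ne_zero.mpr hyx.symm
  simp only [hK]
  rw [intervalIntegral.integral_mul_const, integral_cos_segment hyx]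
  field_simp
  ring
end

section
/- Let f : ℝ → ℂ be a Schwartz function. Then for every x ∈ ℝ the principal value PV∫_ℝ f(y)/(x−y) dy exists and equals (1/2)·∫_ℝ (−i·sgn(k))·f̂(k)·e^{ikx} dk, where f̂(k) = ∫_ℝ f(y)·e^{−iky} dy and the integral on the right is absolutely convergent. Equivalently, the Hilbert transform H f(x) = (1/π)·PV∫_ℝ f(y)/(x−y) dy is the Fourier multiplier with symbol −i·sgn(k). -/
open MeasureTheory Filter Set Topology

/-- Symmetrization of the pairing of an integrable function with a bounded odd kernel. -/
theorem integral_mul_odd_kernel {f : ℝ → ℂ} (hf : Integrable f) {K : ℝ → ℂ}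
    (hK : Measurable K) (hodd : ∀ t, K (-t) = -K t) {C : ℝ} (hC : ∀ t, ‖K t‖ ≤ C) (x : ℝ) :
    ∫ y, f y * K (x - y) = (1 / 2) * ∫ t, (f (x - t) - f (x + t)) * K t := by
  have h₁ : Integrable fun t => f (x - t) * K t :=
    (hf.comp_sub_left x).mul_bdd hK.aestronglyMeasurable (.of_forall hC)
  have h₂ : Integrable fun t => f (x + t) * K t :=
    (hf.comp_add_left x).mul_bdd hK.aestronglyMeasurable (.of_forall hC)
  have e₁ : ∫ y, f y * K (x - y) = ∫ t, f (x - t) * K t := by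
    rw [← integral_sub_left_eq_self (fun y => f y * K (x - y)) volume x]
    simp
  have e₂ : ∫ t, f (x + t) * K t = -∫ t, f (x - t) * K t := by
    rw [← integral_neg_eq_self (fun t => f (x + t) * K t), ← integral_neg]
    simp [hodd, sub_eq_add_neg]
  simp_rw [sub_mul]
  rw [integral_sub h₁ h₂, e₁, e₂]
  ring

theorem SchwartzMap.exists_norm_sub_le (f : SchwartzMap ℝ ℂ) :
    ∃ C, 0 ≤ C ∧ ∀ x y, ‖f x - f y‖ ≤ C * |x - y| := by
  obtain ⟨C, hC⟩ := (SchwartzMap.derivCLM ℝ ℂ f).decay 0 0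
  have hC' : ∀ x, ‖deriv f x‖ ≤ C := fun x => by simpa using hC.2 x
  refine ⟨C, (norm_nonneg _).trans (hC' 0), fun x y => ?_⟩
  simpa using convex_univ.norm_image_sub_le_of_norm_deriv_le (𝕜 := ℝ)
    (fun z _ => f.differentiableAt) (fun z _ => hC' z) (mem_univ y) (mem_univ x)

theorem SchwartzMap.integrable_symmetric_difference_quotient (f : SchwartzMap ℝ ℂ) (x : ℝ) :
    Integrable fun t : ℝ => (f (x - t) - f (x + t)) * (t : ℂ)⁻¹ := by
  obtain ⟨C, hC0, hC⟩ := f.exists_norm_sub_le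
  have hg : Integrable fun t : ℝ => f (x - t) - f (x + t) :=
    (f.integrable.comp_sub_left x).sub (f.integrable.comp_add_left x)
  have hb : Integrable ((Icc (-1 : ℝ) 1).indicator fun _ => 2 * C) :=
    (integrable_indicator_iff measurableSet_Icc).2 (integrableOn_const (by simp))
  refine (hb.add hg.norm).mono' (hg.aestronglyMeasurable.mul
    (by fun_prop : Measurable fun t : ℝ => (t : ℂ)⁻¹).aestronglyMeasurable)
    (.of_forall fun t => ?_)
  rw [norm_mul, norm_inv, Complex.norm_real, Real.norm_eq_abs, Pi.add_apply, ← div_eq_mul_inv]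
  have hn := norm_nonneg (f (x - t) - f (x + t))
  by_cases ht : t ∈ Icc (-1 : ℝ) 1
  · rw [indicator_of_mem ht]
    suffices ‖f (x - t) - f (x + t)‖ / |t| ≤ 2 * C by linarith
    refine div_le_of_le_mul₀ (abs_nonneg t) (by positivity) ((hC _ _).trans_eq ?_)
    rw [show x - t - (x + t) = -2 * t by ring, abs_mul]
    norm_num
    ring
  · rw [indicator_of_notMem ht, zero_add]
    have ht' : 1 ≤ |t| := by
      contrapose! ht
      exact abs_le.1 ht.le
    exact div_le_self hn ht'

/-- Odd regularizations of the kernel `1 / t` give rise to the same singular integral. -/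
theorem SchwartzMap.tendsto_integral_mul_odd_kernel (f : SchwartzMap ℝ ℂ) (x : ℝ)
    {K : ℝ → ℝ → ℂ} (hK : ∀ ε, Measurable (K ε)) (hodd : ∀ ε t, K ε (-t) = -K ε t)
    (hbdd : ∀ ε > 0, ∀ t, ‖K ε t‖ ≤ ε⁻¹) (hle : ∀ ε > 0, ∀ t, ‖K ε t‖ ≤ |t|⁻¹)
    (hlim : ∀ t ≠ 0, Tendsto (fun ε => K ε t) (𝓝[>] 0) (𝓝 (t : ℂ)⁻¹)) :
    Tendsto (fun ε => ∫ y, f y * K ε (x - y)) (𝓝[>] 0)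
      (𝓝 ((1 / 2) * ∫ t : ℝ, (f (x - t) - f (x + t)) * (t : ℂ)⁻¹)) := by
  have hpos : ∀ᶠ ε : ℝ in 𝓝[>] 0, 0 < ε := self_mem_nhdsWithin
  have key : Tendsto (fun ε => ∫ t, (f (x - t) - f (x + t)) * K ε t) (𝓝[>] 0)
      (𝓝 (∫ t : ℝ, (f (x - t) - f (x + t)) * (t : ℂ)⁻¹)) := by
    refine tendsto_integral_filter_of_dominated_convergence _ (.of_forall fun ε => ?_) ?_
      (f.integrable_symmetric_difference_quotient x).norm ?_
    · have hc : Continuous fun t => f (x - t) - f (x + t) := by fun_prop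
      exact hc.aestronglyMeasurable.mul (hK ε).aestronglyMeasurable
    · filter_upwards [hpos] with ε hε
      refine .of_forall fun t => ?_
      rw [norm_mul, norm_mul, norm_inv, Complex.norm_real, Real.norm_eq_abs]
      gcongr
      exact hle ε hε t
    · filter_upwards [Measure.ae_ne volume (0 : ℝ)] with t ht
      exact (hlim t ht).const_mul _
  refine (key.const_mul (1 / 2)).congr' ?_
  filter_upwards [hpos] with ε hε
  exact (integral_mul_odd_kernel f.integrable (hK ε) (hodd ε) (hbdd ε hε) x).symm

theorem SchwartzMap.tendsto_truncated_integral (f : SchwartzMap ℝ ℂ) (x : ℝ) :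
    Tendsto (fun ε : ℝ => ∫ y in {y : ℝ | ε < |y - x|}, f y / ((x : ℂ) - (y : ℂ))) (𝓝[>] 0)
      (𝓝 ((1 / 2) * ∫ t : ℝ, (f (x - t) - f (x + t)) * (t : ℂ)⁻¹)) := by
  have hm : ∀ ε : ℝ, MeasurableSet {t : ℝ | ε < |t|} := fun ε =>
    measurableSet_lt measurable_const (by fun_prop)
  refine (f.tendsto_integral_mul_odd_kernel x
    (K := fun ε => {t : ℝ | ε < |t|}.indicator fun t => (t : ℂ)⁻¹)
    (fun ε => Measurable.indicator (by fun_prop) (hm ε)) ?_ ?_ ?_ ?_).congr fun ε => ?_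
  · intro ε t
    by_cases h : ε < |t| <;> simp [indicator, h, inv_neg]
  · intro ε hε t
    by_cases h : ε < |t|
    · simpa [indicator, h] using inv_anti₀ hε h.le
    · simpa [indicator, h] using hε.le
  · intro ε hε t
    by_cases h : ε < |t| <;> simp [indicator, h]
  · intro t ht
    refine tendsto_const_nhds.congr' ?_
    filter_upwards [nhdsWithin_le_nhds (eventually_lt_nhds (abs_pos.2 ht))] with ε hε
    simp [indicator, hε]
  · have hs : MeasurableSet {y : ℝ | ε < |y - x|} :=
      measurableSet_lt measurable_const (by fun_prop)
    rw [← integral_indicator hs]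
    refine integral_congr_ae (.of_forall fun y => ?_)
    by_cases h : ε < |y - x|
    · simp [indicator, h, abs_sub_comm x y, div_eq_mul_inv]
    · simp [indicator, h, abs_sub_comm x y]

theorem SchwartzMap.tendsto_conjugate_poisson_integral (f : SchwartzMap ℝ ℂ) (x : ℝ) :
    Tendsto (fun δ : ℝ => ∫ y, f y * (((x - y) / ((x - y) ^ 2 + δ ^ 2) : ℝ) : ℂ)) (𝓝[>] 0)
      (𝓝 ((1 / 2) * ∫ t : ℝ, (f (x - t) - f (x + t)) * (t : ℂ)⁻¹)) := by
  refine f.tendsto_integral_mul_odd_kernel x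
    (K := fun δ t => ((t / (t ^ 2 + δ ^ 2) : ℝ) : ℂ)) (fun δ => by fun_prop) ?_ ?_ ?_ ?_
  · intro δ t
    simp [neg_div]
  · intro δ hδ t
    rw [Complex.norm_real, Real.norm_eq_abs, abs_div, abs_of_pos (by positivity : 0 < t ^ 2 + δ ^ 2),
      div_le_iff₀ (by positivity), ← sq_abs t, inv_mul_eq_div, le_div_iff₀ hδ]
    nlinarith [sq_nonneg (|t| - δ), sq_nonneg |t|, sq_nonneg δ]
  · intro δ hδ t
    rcases eq_or_ne t 0 with rfl | ht
    · simp
    have := abs_pos.2 ht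
    rw [Complex.norm_real, Real.norm_eq_abs, abs_div, abs_of_pos (by positivity : 0 < t ^ 2 + δ ^ 2),
      div_le_iff₀ (by positivity), ← sq_abs t, inv_mul_eq_div, le_div_iff₀ this]
    nlinarith [sq_nonneg δ]
  · intro t ht
    have hc : ContinuousAt (fun δ : ℝ => t / (t ^ 2 + δ ^ 2)) 0 :=
      ContinuousAt.div (by fun_prop) (by fun_prop) (by simpa using ht)
    have h := hc.tendsto.mono_left (nhdsWithin_le_nhds (s := Ioi 0))
    have e : t / (t ^ 2 + 0 ^ 2) = t⁻¹ := by field_simp; simp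
    rw [e] at h
    rw [← Complex.ofReal_inv]
    exact (Complex.continuous_ofReal.tendsto _).comp h

theorem sign_mul_exp_neg_mul_abs_ae_Iic (δ t : ℝ) :
    (fun k : ℝ => -Complex.exp ((δ + Complex.I * t) * k)) =ᵐ[volume.restrict (Iic 0)]
      fun k : ℝ => (Real.sign k * Real.exp (-δ * |k|) : ℂ) * Complex.exp (Complex.I * k * t) := by
  filter_upwards [ae_restrict_mem measurableSet_Iic,
    ae_restrict_of_ae (Measure.ae_ne volume (0 : ℝ))] with k hk hk0
  have hk' : k < 0 := lt_of_le_of_ne hk hk0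
  rw [Real.sign_of_neg hk', abs_of_neg hk']
  push_cast
  rw [neg_one_mul, neg_mul, ← Complex.exp_add]
  ring_nf

theorem sign_mul_exp_neg_mul_abs_ae_Ioi (δ t : ℝ) :
    (fun k : ℝ => Complex.exp ((-δ + Complex.I * t) * k)) =ᵐ[volume.restrict (Ioi 0)]
      fun k : ℝ => (Real.sign k * Real.exp (-δ * |k|) : ℂ) * Complex.exp (Complex.I * k * t) := by
  filter_upwards [ae_restrict_mem measurableSet_Ioi] with k hk
  rw [Real.sign_of_pos hk, abs_of_pos hk]
  push_cast
  rw [one_mul, ← Complex.exp_add]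
  ring_nf

theorem integrable_sign_mul_exp_neg_mul_abs_mul_exp {δ : ℝ} (hδ : 0 < δ) (t : ℝ) :
    Integrable fun k : ℝ =>
      (Real.sign k * Real.exp (-δ * |k|) : ℂ) * Complex.exp (Complex.I * k * t) := by
  rw [← integrableOn_univ, ← Iic_union_Ioi (a := (0 : ℝ))]
  refine IntegrableOn.union ?_ ?_
  · exact (integrableOn_exp_mul_complex_Iic (by simpa) 0).neg.congr
      (sign_mul_exp_neg_mul_abs_ae_Iic δ t)
  · exact (integrableOn_exp_mul_complex_Ioi (by simpa) 0).congr
      (sign_mul_exp_neg_mul_abs_ae_Ioi δ t)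

theorem integral_sign_mul_exp_neg_mul_abs_mul_exp {δ : ℝ} (hδ : 0 < δ) (t : ℝ) :
    ∫ k : ℝ, (Real.sign k * Real.exp (-δ * |k|) : ℂ) * Complex.exp (Complex.I * k * t) =
      2 * Complex.I * ((t / (t ^ 2 + δ ^ 2) : ℝ) : ℂ) := by
  have hi := integrable_sign_mul_exp_neg_mul_abs_mul_exp hδ t
  rw [← intervalIntegral.integral_Iic_add_Ioi (b := (0 : ℝ)) hi.integrableOn hi.integrableOn,
    ← integral_congr_ae (sign_mul_exp_neg_mul_abs_ae_Iic δ t),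
    ← integral_congr_ae (sign_mul_exp_neg_mul_abs_ae_Ioi δ t), integral_neg,
    integral_exp_mul_complex_Iic (by simpa), integral_exp_mul_complex_Ioi (by simpa)]
  have h₁ : (δ + Complex.I * t : ℂ) ≠ 0 := fun h => hδ.ne' (by simpa using congrArg Complex.re h)
  have h₂ : (-δ + Complex.I * t : ℂ) ≠ 0 := fun h => hδ.ne' (by simpa using congrArg Complex.re h)
  have h₃ : (t ^ 2 + δ ^ 2 : ℂ) ≠ 0 := by
    exact_mod_cast (by positivity : t ^ 2 + δ ^ 2 ≠ 0)
  push_cast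
  simp only [mul_zero, Complex.exp_zero]
  field_simp
  linear_combination (-2 * Complex.I * t ^ 3 : ℂ) * Complex.I_sq

/-- The Abel means of the Fourier multiplier `-i sgn k` are conjugate Poisson integrals. -/
theorem integral_abel_mean_fourier_multiplier {f : ℝ → ℂ} (hf : Integrable f) {δ : ℝ}
    (hδ : 0 < δ) (x : ℝ) :
    (1 / 2) * ∫ k : ℝ, Real.exp (-δ * |k|) * ((-Complex.I * (Real.sign k : ℂ))
      * (∫ y : ℝ, f y * Complex.exp (-Complex.I * (k : ℂ) * (y : ℂ)))
      * Complex.exp (Complex.I * (k : ℂ) * (x : ℂ))) =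
    ∫ y, f y * (((x - y) / ((x - y) ^ 2 + δ ^ 2) : ℝ) : ℂ) := by
  have hm : Integrable fun k : ℝ => (Real.sign k * Real.exp (-δ * |k|) : ℂ) := by
    simpa using integrable_sign_mul_exp_neg_mul_abs_mul_exp hδ 0
  let G : ℝ → ℝ → ℂ := fun k y => f y * ((Real.sign k * Real.exp (-δ * |k|) : ℂ)
    * Complex.exp (Complex.I * k * (x - y : ℝ)))
  have hG : Integrable (Function.uncurry G) (volume.prod volume) := by
    refine ((hm.mul_prod hf).mul_bdd (c := 1)
      (g := fun z : ℝ × ℝ => Complex.exp (Complex.I * z.1 * (x - z.2 : ℝ)))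
      (by fun_prop) (.of_forall fun z => ?_)).congr (.of_forall fun z => ?_)
    · simp [Complex.norm_exp]
    · simp only [Function.uncurry, G]
      ring
  have e : ∀ k : ℝ, Real.exp (-δ * |k|) * ((-Complex.I * (Real.sign k : ℂ))
      * (∫ y : ℝ, f y * Complex.exp (-Complex.I * (k : ℂ) * (y : ℂ)))
      * Complex.exp (Complex.I * (k : ℂ) * (x : ℂ))) = -Complex.I * ∫ y, G k y := by
    intro k
    have : ∀ y, G k y = (Real.sign k * Real.exp (-δ * |k|) * Complex.exp (Complex.I * k * x) : ℂ)
        * (f y * Complex.exp (-Complex.I * (k : ℂ) * (y : ℂ))) := by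
      intro y
      simp only [G]
      rw [show Complex.I * k * (x - y : ℝ) = Complex.I * k * x + -Complex.I * k * y by
        push_cast; ring, Complex.exp_add]
      ring
    simp_rw [this, integral_const_mul]
    ring
  simp_rw [e]
  rw [integral_const_mul, integral_integral_swap hG]
  simp_rw [G, integral_const_mul, integral_sign_mul_exp_neg_mul_abs_mul_exp hδ]
  rw [← integral_const_mul, ← integral_const_mul]
  refine integral_congr_ae (.of_forall fun y => ?_)
  simp only
  generalize (((x - y) / ((x - y) ^ 2 + δ ^ 2) : ℝ) : ℂ) = c
  linear_combination (-(f y) * c) * Complex.I_sq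

theorem SchwartzMap.integrable_integral_mul_exp (f : SchwartzMap ℝ ℂ) :
    Integrable fun k : ℝ => ∫ y : ℝ, f y * Complex.exp (-Complex.I * (k : ℂ) * (y : ℂ)) := by
  have h := (FourierTransform.fourier f : SchwartzMap ℝ ℂ).integrable (μ := volume) |>.comp_div
    (R := 2 * Real.pi) (by positivity)
  refine h.congr (.of_forall fun k => ?_)
  simp only [SchwartzMap.fourier_coe, Real.fourier_real_eq_integral_exp_smul, smul_eq_mul]
  refine integral_congr_ae (.of_forall fun y => ?_)
  simp only
  rw [mul_comm]
  congr 2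
  have : (Real.pi : ℂ) ≠ 0 := by exact_mod_cast Real.pi_ne_zero
  push_cast
  field_simp

/-- Abel summability of the integral of an integrable function. -/
theorem tendsto_integral_exp_neg_mul_abs_mul {g : ℝ → ℂ} (hg : Integrable g) :
    Tendsto (fun δ : ℝ => ∫ k, Real.exp (-δ * |k|) * g k) (𝓝[>] 0) (𝓝 (∫ k, g k)) := by
  refine tendsto_integral_filter_of_dominated_convergence _ (.of_forall fun δ => ?_) ?_ hg.norm
    (.of_forall fun k => ?_)
  · have hc : Continuous fun k : ℝ => (Real.exp (-δ * |k|) : ℂ) := by fun_prop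
    exact hc.aestronglyMeasurable.mul hg.aestronglyMeasurable
  · filter_upwards [self_mem_nhdsWithin] with δ hδ
    refine .of_forall fun k => ?_
    rw [norm_mul]
    refine mul_le_of_le_one_left (norm_nonneg _) ?_
    rw [Complex.norm_real, Real.norm_eq_abs, Real.abs_exp, Real.exp_le_one_iff, neg_mul,
      neg_nonpos]
    exact mul_nonneg (le_of_lt hδ) (abs_nonneg k)
  · have hc : Continuous fun δ : ℝ => (Real.exp (-δ * |k|) : ℂ) * g k := by fun_prop
    simpa using (hc.tendsto 0).mono_left (nhdsWithin_le_nhds (s := Ioi 0))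

/-- For a Schwartz function `f : ℝ → ℂ` and every `x ∈ ℝ`, the
principal value `PV∫_ℝ f(y)/(x−y) dy` exists and equals
`(1/2)·∫_ℝ (−i·sgn(k))·f̂(k)·e^{ikx} dk` where `f̂(k) = ∫_ℝ f(y)·e^{−iky} dy`:
the Hilbert transform `(1/π)·PV∫ f(y)/(x−y) dy` is the Fourier multiplier with
symbol `−i·sgn(k)`. -/
theorem pv_fourier_multiplier (f : SchwartzMap ℝ ℂ) (x : ℝ) :
    Tendsto
      (fun ε : ℝ => ∫ y in {y : ℝ | ε < |y - x|}, f y / ((x : ℂ) - (y : ℂ)))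
      (𝓝[>] 0)
      (𝓝 ((1 / 2) * ∫ k : ℝ,
        (-Complex.I * (Real.sign k : ℂ))
          * (∫ y : ℝ, f y * Complex.exp (-Complex.I * (k : ℂ) * (y : ℂ)))
          * Complex.exp (Complex.I * (k : ℂ) * (x : ℂ)))) := by
  have hsign : Measurable Real.sign :=
    Measurable.ite measurableSet_Iio measurable_const
      (Measurable.ite measurableSet_Ioi measurable_const measurable_const)
  have hF : Integrable fun k : ℝ => (-Complex.I * (Real.sign k : ℂ))
      * (∫ y : ℝ, f y * Complex.exp (-Complex.I * (k : ℂ) * (y : ℂ)))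
      * Complex.exp (Complex.I * (k : ℂ) * (x : ℂ)) := by
    refine (f.integrable_integral_mul_exp.bdd_mul (c := 1) (by fun_prop)
      (.of_forall fun k => ?_)).mul_bdd (c := 1) (by fun_prop) (.of_forall fun k => ?_)
    · rcases Real.sign_apply_eq k with h | h | h <;> simp [h]
    · simp [Complex.norm_exp]
  have hlim := tendsto_nhds_unique (f.tendsto_conjugate_poisson_integral x)
    (((tendsto_integral_exp_neg_mul_abs_mul hF).const_mul (1 / 2)).congr' (by
      filter_upwards [self_mem_nhdsWithin] with δ hδ
      exact integral_abel_mean_fourier_multiplier f.integrable hδ x))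
  rw [← hlim]
  exact f.tendsto_truncated_integral x
end
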